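/- arXiv:2101.01041 — 6 statements merged into one kernel-verified Lean document; each statement's English description precedes it below -/
import Mathlib

section
/- (Nonconvexity–nonconcavity.) There exist a horizon N ≥ 1, dimensions m, d, n, and game data (A_t, B_t, D_t, symmetric positive semidefinite Q_t and Q_N, symmetric positive definite R^u_t, R^w_t, Σ⁰_t) such that: (i) there are an admissible gain K ∈ 𝒦 and maximizer gains L¹, L² with G(K,L¹) + G(K,L²) > 2 · G(K, (L¹+L²)/2), so L ↦ G(K,L) is not concave; and (ii) there are a maximizer gain L and minimizer gains K¹, K² with G(K¹,L) + G(K²,L) < 2 · G((K¹+K²)/2, L), so K ↦ G(K,L) is not convex. -/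
open Matrix

noncomputable section

/-- Rayleigh-quotient value set of a square real matrix. -/
def rayleighSet {a : ℕ} (M : Matrix (Fin a) (Fin a) ℝ) : Set ℝ :=
  { r : ℝ | ∃ x : Fin a → ℝ, x ⬝ᵥ x = 1 ∧ r = x ⬝ᵥ M.mulVec x }

/-- Smallest eigenvalue (of a symmetric matrix), via the Rayleigh characterization. -/
def eigMin {a : ℕ} (M : Matrix (Fin a) (Fin a) ℝ) : ℝ := sInf (rayleighSet M)

/-- Largest eigenvalue (of a symmetric matrix), via the Rayleigh characterization. -/
def eigMax {a : ℕ} (M : Matrix (Fin a) (Fin a) ℝ) : ℝ := sSup (rayleighSet M)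

/-- Operator (spectral) norm of a real matrix. -/
def opNorm {a b : ℕ} (M : Matrix (Fin a) (Fin b) ℝ) : ℝ := Real.sqrt (eigMax (Mᵀ * M))

/-- Squared Frobenius norm. -/
def frobNormSq {a b : ℕ} (M : Matrix (Fin a) (Fin b) ℝ) : ℝ := ∑ i, ∑ j, (M i j) ^ 2

/-- Frobenius norm. -/
def frobNorm {a b : ℕ} (M : Matrix (Fin a) (Fin b) ℝ) : ℝ := Real.sqrt (frobNormSq M)

/-- Extend a finite tuple to a function on `ℕ` by zero. -/
def padZero {α : Type*} [Zero α] {N : ℕ} (f : Fin N → α) : ℕ → α :=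
  fun t => if h : t < N then f ⟨t, h⟩ else 0

/-- Data of a finite-horizon zero-sum LQ dynamic game with horizon `N`. -/
structure LQGame (m d n N : ℕ) where
  A : ℕ → Matrix (Fin m) (Fin m) ℝ
  B : ℕ → Matrix (Fin m) (Fin d) ℝ
  D : ℕ → Matrix (Fin m) (Fin n) ℝ
  Q : ℕ → Matrix (Fin m) (Fin m) ℝ
  QN : Matrix (Fin m) (Fin m) ℝ
  Ru : ℕ → Matrix (Fin d) (Fin d) ℝ
  Rw : ℕ → Matrix (Fin n) (Fin n) ℝ
  Sig : ℕ → Matrix (Fin m) (Fin m) ℝ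
  hQ : ∀ t < N, (Q t).PosSemidef
  hQN : QN.PosSemidef
  hRu : ∀ t < N, (Ru t).PosDef
  hRw : ∀ t < N, (Rw t).PosDef
  hSig : ∀ t ≤ N, (Sig t).PosDef

namespace LQGame

variable {m d n N : ℕ}

/-- Value matrices `P^{K,L}` indexed by the number `j` of steps before the terminal
time, i.e. `PKLaux g K L j = P^{K,L}_{N-j}`. -/
def PKLaux (g : LQGame m d n N) (K : ℕ → Matrix (Fin d) (Fin m) ℝ)
    (L : ℕ → Matrix (Fin n) (Fin m) ℝ) : ℕ → Matrix (Fin m) (Fin m) ℝ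
  | 0 => g.QN
  | j + 1 =>
      (g.A (N - (j+1)) - g.B (N - (j+1)) * K (N - (j+1)) - g.D (N - (j+1)) * L (N - (j+1)))ᵀ *
          PKLaux g K L j *
          (g.A (N - (j+1)) - g.B (N - (j+1)) * K (N - (j+1)) - g.D (N - (j+1)) * L (N - (j+1)))
        + g.Q (N - (j+1)) + (K (N - (j+1)))ᵀ * g.Ru (N - (j+1)) * K (N - (j+1))
        - (L (N - (j+1)))ᵀ * g.Rw (N - (j+1)) * L (N - (j+1))

/-- Value matrix `P^{K,L}_t`. -/
def PKL (g : LQGame m d n N) (K : ℕ → Matrix (Fin d) (Fin m) ℝ)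
    (L : ℕ → Matrix (Fin n) (Fin m) ℝ) (t : ℕ) : Matrix (Fin m) (Fin m) ℝ :=
  PKLaux g K L (N - t)

/-- Inner-loop Riccati matrices indexed by the number `j` of steps before the terminal
time, i.e. `PKaux g K j = P^K_{N-j}`. -/
def PKaux (g : LQGame m d n N) (K : ℕ → Matrix (Fin d) (Fin m) ℝ) :
    ℕ → Matrix (Fin m) (Fin m) ℝ
  | 0 => g.QN
  | j + 1 =>
      g.Q (N - (j+1)) + (K (N - (j+1)))ᵀ * g.Ru (N - (j+1)) * K (N - (j+1))
        + (g.A (N - (j+1)) - g.B (N - (j+1)) * K (N - (j+1)))ᵀ *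
          (PKaux g K j + PKaux g K j * g.D (N - (j+1)) *
            (g.Rw (N - (j+1)) - (g.D (N - (j+1)))ᵀ * PKaux g K j * g.D (N - (j+1)))⁻¹ *
            (g.D (N - (j+1)))ᵀ * PKaux g K j) *
          (g.A (N - (j+1)) - g.B (N - (j+1)) * K (N - (j+1)))

/-- Inner-loop Riccati matrix `P^K_t`. -/
def PK (g : LQGame m d n N) (K : ℕ → Matrix (Fin d) (Fin m) ℝ) (t : ℕ) :
    Matrix (Fin m) (Fin m) ℝ :=
  PKaux g K (N - t)

/-- `P̃^K_{t+1}`. -/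
def Ptilde (g : LQGame m d n N) (K : ℕ → Matrix (Fin d) (Fin m) ℝ) (t : ℕ) :
    Matrix (Fin m) (Fin m) ℝ :=
  g.PK K (t+1) + g.PK K (t+1) * g.D t *
    (g.Rw t - (g.D t)ᵀ * g.PK K (t+1) * g.D t)⁻¹ * (g.D t)ᵀ * g.PK K (t+1)

/-- `K ∈ 𝒦`. -/
def Admissible (g : LQGame m d n N) (K : ℕ → Matrix (Fin d) (Fin m) ℝ) : Prop :=
  ∀ t < N, (g.Rw t - (g.D t)ᵀ * g.PK K (t+1) * g.D t).PosDef

/-- The inner maximizer `L(K)`. -/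
def Lopt (g : LQGame m d n N) (K : ℕ → Matrix (Fin d) (Fin m) ℝ) (t : ℕ) :
    Matrix (Fin n) (Fin m) ℝ :=
  (-(g.Rw t) + (g.D t)ᵀ * g.PK K (t+1) * g.D t)⁻¹ *
    ((g.D t)ᵀ * g.PK K (t+1) * (g.A t - g.B t * K t))

/-- State covariances `X^{K,L}_t`. -/
def Xcov (g : LQGame m d n N) (K : ℕ → Matrix (Fin d) (Fin m) ℝ)
    (L : ℕ → Matrix (Fin n) (Fin m) ℝ) : ℕ → Matrix (Fin m) (Fin m) ℝ
  | 0 => g.Sig 0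
  | t + 1 =>
      (g.A t - g.B t * K t - g.D t * L t) * Xcov g K L t *
        (g.A t - g.B t * K t - g.D t * L t)ᵀ + g.Sig (t+1)

/-- The game value `G(K,L)`. -/
def value (g : LQGame m d n N) (K : ℕ → Matrix (Fin d) (Fin m) ℝ)
    (L : ℕ → Matrix (Fin n) (Fin m) ℝ) : ℝ :=
  ∑ t ∈ Finset.range (N+1), ((g.PKL K L t) * g.Sig t).trace

/-- `E^{K,L}_t`. -/
def Emat (g : LQGame m d n N) (K : ℕ → Matrix (Fin d) (Fin m) ℝ)
    (L : ℕ → Matrix (Fin n) (Fin m) ℝ) (t : ℕ) : Matrix (Fin n) (Fin m) ℝ :=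
  (-(g.Rw t) + (g.D t)ᵀ * g.PKL K L (t+1) * g.D t) * L t -
    (g.D t)ᵀ * g.PKL K L (t+1) * (g.A t - g.B t * K t)

/-- `H^{K,L}_t`. -/
def Hmat (g : LQGame m d n N) (K : ℕ → Matrix (Fin d) (Fin m) ℝ)
    (L : ℕ → Matrix (Fin n) (Fin m) ℝ) (t : ℕ) : Matrix (Fin n) (Fin n) ℝ :=
  g.Rw t - (g.D t)ᵀ * g.PKL K L (t+1) * g.D t

/-- `F^K_t`. -/
def Fmat (g : LQGame m d n N) (K : ℕ → Matrix (Fin d) (Fin m) ℝ) (t : ℕ) :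
    Matrix (Fin d) (Fin m) ℝ :=
  (g.Ru t + (g.B t)ᵀ * g.Ptilde K t * g.B t) * K t - (g.B t)ᵀ * g.Ptilde K t * g.A t

/-- `G^K_t`. -/
def Gmat (g : LQGame m d n N) (K : ℕ → Matrix (Fin d) (Fin m) ℝ) (t : ℕ) :
    Matrix (Fin d) (Fin d) ℝ :=
  g.Ru t + (g.B t)ᵀ * g.Ptilde K t * g.B t

/-- Game Riccati recursion `P*` indexed by steps before terminal time. -/
def Pstaraux (g : LQGame m d n N) : ℕ → Matrix (Fin m) (Fin m) ℝ
  | 0 => g.QN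
  | j + 1 =>
      g.Q (N - (j+1)) + (g.A (N - (j+1)))ᵀ * Pstaraux g j *
        (1 + (g.B (N - (j+1)) * (g.Ru (N - (j+1)))⁻¹ * (g.B (N - (j+1)))ᵀ
            - g.D (N - (j+1)) * (g.Rw (N - (j+1)))⁻¹ * (g.D (N - (j+1)))ᵀ) * Pstaraux g j)⁻¹ *
        g.A (N - (j+1))

/-- `P*_t`. -/
def Pstar (g : LQGame m d n N) (t : ℕ) : Matrix (Fin m) (Fin m) ℝ :=
  Pstaraux g (N - t)

/-- `Λ_t` of the game Riccati recursion. -/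
def LambdaStar (g : LQGame m d n N) (t : ℕ) : Matrix (Fin m) (Fin m) ℝ :=
  1 + (g.B t * (g.Ru t)⁻¹ * (g.B t)ᵀ - g.D t * (g.Rw t)⁻¹ * (g.D t)ᵀ) * g.Pstar (t+1)

/-- Assumption 2.4. -/
def Assumption24 (g : LQGame m d n N) : Prop :=
  (∀ t < N, IsUnit (g.LambdaStar t)) ∧ (∀ t ≤ N, (g.Pstar t).PosSemidef) ∧
    (∀ t < N, (g.Rw t - (g.D t)ᵀ * g.Pstar (t+1) * g.D t).PosDef)

/-- `φ := min_{0 ≤ t ≤ N} λ_min(Σ⁰_t)`. -/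
def phi (g : LQGame m d n N) : ℝ :=
  (Finset.range (N+1)).inf' (Finset.nonempty_range_iff.mpr (Nat.succ_ne_zero N))
    (fun t => eigMin (g.Sig t))

end LQGame
namespace LQGame

/-- The scalar driftless two-stage game `x' = -(u + w)` with unit control weights, no state
costs and unit noise. -/
def driftlessScalarGame : LQGame 1 1 1 2 where
  A _ := 0
  B _ := 1
  D _ := 1
  Q _ := 0
  QN := 0
  Ru _ := 1
  Rw _ := 1
  Sig _ := 1
  hQ _ _ := PosSemidef.zero
  hQN := PosSemidef.zero
  hRu _ _ := PosDef.one
  hRw _ _ := PosDef.one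
  hSig _ _ := PosDef.one

lemma driftlessScalarGame_value (K L : ℕ → Matrix (Fin 1) (Fin 1) ℝ) :
    driftlessScalarGame.value K L =
      (K 0 0 0 + L 0 0 0) ^ 2 * (K 1 0 0 ^ 2 - L 1 0 0 ^ 2) + K 0 0 0 ^ 2 - L 0 0 0 ^ 2
        + (K 1 0 0 ^ 2 - L 1 0 0 ^ 2) := by
  simp [value, PKL, PKLaux, driftlessScalarGame, Finset.sum_range_succ, Matrix.trace,
    Matrix.mul_apply]
  ring

lemma driftlessScalarGame_PK_zero (t : ℕ) :
    driftlessScalarGame.PK 0 t = 0 := by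
  unfold PK
  cases 2 - t <;> simp [PKaux, driftlessScalarGame]

lemma driftlessScalarGame_admissible_zero : driftlessScalarGame.Admissible 0 := by
  intro t _
  rw [driftlessScalarGame_PK_zero]
  simpa [driftlessScalarGame] using (PosDef.one : (1 : Matrix (Fin 1) (Fin 1) ℝ).PosDef)

end LQGame

/-- there exist zero-sum LQ games whose objective is neither concave in `L`
(for some admissible `K`) nor convex in `K` (for some `L`). -/
theorem LQGame.exists_nonconvex_nonconcave :
    ∃ (m d n N : ℕ) (g : LQGame m d n N), 0 < N
      ∧ (∃ (K : ℕ → Matrix (Fin d) (Fin m) ℝ) (L1 L2 : ℕ → Matrix (Fin n) (Fin m) ℝ),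
          g.Admissible K
          ∧ 2 * g.value K (fun t => (1/2 : ℝ) • (L1 t + L2 t)) < g.value K L1 + g.value K L2)
      ∧ (∃ (L : ℕ → Matrix (Fin n) (Fin m) ℝ) (K1 K2 : ℕ → Matrix (Fin d) (Fin m) ℝ),
          g.value K1 L + g.value K2 L < 2 * g.value (fun t => (1/2 : ℝ) • (K1 t + K2 t)) L) := by
  refine ⟨1, 1, 1, 2, driftlessScalarGame, by norm_num,
    ⟨0, fun t => if t = 0 then 4 else 0, fun t => if t = 0 then 0 else 4,
      driftlessScalarGame_admissible_zero, ?_⟩,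
    ⟨fun t => if t = 0 then 0 else 2, fun t => if t = 0 then 1 else 0,
      fun t => if t = 0 then -1 else 0, ?_⟩⟩
  · simp only [driftlessScalarGame_value]
    norm_num [Matrix.ofNat_apply]
  · simp only [driftlessScalarGame_value]
    norm_num [Matrix.ofNat_apply]
end
end

section
/- (Outer-loop landscape: nonconvexity and noncoercivity.) There exist a horizon N ≥ 1, dimensions m, d, n, and game data such that: (i) there are admissible minimizer gains K¹, K² ∈ 𝒦 with K³ := (K¹+K²)/2 ∈ 𝒦 and G(K¹, L(K¹)) + G(K², L(K²)) < 2 · G(K³, L(K³)), so K ↦ G(K, L(K)) is not convex on 𝒦; and (ii) there exist a sequence of admissible gains K^{(j)} ∈ 𝒦 and a gain K̄ ∉ 𝒦 such that K^{(j)} → K̄ while sup_j G(K^{(j)}, L(K^{(j)})) < +∞, so G(K, L(K)) does not tend to +∞ as K approaches the boundary of 𝒦 (noncoercivity). -/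
open Matrix

noncomputable section

namespace LQGame

/-- Scalar two-stage game with `A = B = D = 1`, no state cost, `Rᵘ = 1/100` and `Rʷ = 1`. -/
def scalarGame : LQGame 1 1 1 2 where
  A _ := 1
  B _ := 1
  D _ := 1
  Q _ := 0
  QN := 0
  Ru _ := (1 / 100 : ℝ) • 1
  Rw _ := 1
  Sig _ := 1
  hQ _ _ := .zero
  hQN := .zero
  hRu _ _ := Matrix.PosDef.one.smul (by norm_num)
  hRw _ _ := .one
  hSig _ _ := .one

/-- The gain of `scalarGame` equal to `x` at time `0` and to `y` at every later time. -/
def scalarGain (x y : ℝ) : ℕ → Matrix (Fin 1) (Fin 1) ℝ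
  | 0 => x • 1
  | _ + 1 => y • 1

theorem inv_smul_one_fin_one (c : ℝ) :
    (c • (1 : Matrix (Fin 1) (Fin 1) ℝ))⁻¹ = c⁻¹ • 1 := by
  ext i j
  simp [Matrix.inv_subsingleton, Subsingleton.elim i j]

theorem posDef_smul_one_fin_one_iff (c : ℝ) :
    (c • (1 : Matrix (Fin 1) (Fin 1) ℝ)).PosDef ↔ 0 < c := by
  refine ⟨fun h => ?_, fun h => Matrix.PosDef.one.smul h⟩
  simpa using h.diag_pos (i := 0)

theorem PK_scalarGame_two (x y : ℝ) : scalarGame.PK (scalarGain x y) 2 = 0 := rfl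

theorem PK_scalarGame_one (x y : ℝ) :
    scalarGame.PK (scalarGain x y) 1 = (y ^ 2 / 100) • 1 := by
  simp [PK, PKaux, scalarGame, scalarGain, smul_smul]
  ring_nf

theorem admissible_scalarGain_iff (x y : ℝ) :
    scalarGame.Admissible (scalarGain x y) ↔ y ^ 2 / 100 < 1 := by
  have hone : (1 : Matrix (Fin 1) (Fin 1) ℝ) - (y ^ 2 / 100) • 1 = (1 - y ^ 2 / 100) • 1 := by
    rw [sub_smul, one_smul]
  have hzero : (scalarGame.Rw 0 - (scalarGame.D 0)ᵀ *
      scalarGame.PK (scalarGain x y) 1 * scalarGame.D 0).PosDef ↔ y ^ 2 / 100 < 1 := by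
    rw [PK_scalarGame_one]
    simp only [scalarGame, Matrix.transpose_one, one_mul, mul_one]
    rw [hone, posDef_smul_one_fin_one_iff, sub_pos]
  refine ⟨fun h => hzero.mp (h 0 two_pos), fun h t ht => ?_⟩
  interval_cases t
  · exact hzero.mpr h
  · rw [PK_scalarGame_two]
    simpa [scalarGame] using Matrix.PosDef.one

theorem value_scalarGain {x y : ℝ} (h : y ^ 2 / 100 < 1) :
    scalarGame.value (scalarGain x y) (scalarGame.Lopt (scalarGain x y)) =
      x ^ 2 / 100 + y ^ 2 / 100 + (1 - x) ^ 2 * (y ^ 2 / (100 - y ^ 2)) := by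
  have hL₁ : scalarGame.Lopt (scalarGain x y) 1 = 0 := by
    simp [Lopt, PK_scalarGame_two]
  have hL₀ : scalarGame.Lopt (scalarGain x y) 0 =
      ((y ^ 2 / 100 - 1)⁻¹ * (y ^ 2 / 100 * (1 - x))) • 1 := by
    have hone : -(1 : Matrix (Fin 1) (Fin 1) ℝ) + (y ^ 2 / 100) • 1
        = (y ^ 2 / 100 - 1) • 1 := by
      rw [sub_smul, one_smul]; abel
    have hx : (1 : Matrix (Fin 1) (Fin 1) ℝ) - x • 1 = (1 - x) • 1 := by
      rw [sub_smul, one_smul]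
    rw [Lopt, PK_scalarGame_one]
    simp only [scalarGame, scalarGain, Matrix.transpose_one, one_mul, mul_one]
    rw [hone, hx, inv_smul_one_fin_one]
    simp only [smul_mul_smul_comm, mul_one]
  have h₁ : y ^ 2 / 100 - 1 ≠ 0 := by linarith
  have h₂ : 100 - y ^ 2 ≠ 0 := by linarith
  have h₃ : y ^ 2 - 100 ≠ 0 := by linarith
  simp only [value, PKL, Finset.sum_range_succ, Finset.sum_range_zero, PKLaux, hL₁, hL₀,
    Nat.sub_zero, Nat.sub_self, Nat.reduceSub, Nat.reduceAdd, zero_add]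
  simp [scalarGame, scalarGain, Matrix.trace, Matrix.mul_apply]
  field_simp
  ring

theorem half_smul_scalarGain_add (x₁ y₁ x₂ y₂ : ℝ) :
    (fun t => (1 / 2 : ℝ) • (scalarGain x₁ y₁ t + scalarGain x₂ y₂ t)) =
      scalarGain ((x₁ + x₂) / 2) ((y₁ + y₂) / 2) := by
  funext t
  cases t <;> simp only [scalarGain, ← add_smul, smul_smul] <;> congr 1 <;> ring

theorem tendsto_scalarGain {u : ℕ → ℝ} {y : ℝ} (x : ℝ)
    (hu : Filter.Tendsto u Filter.atTop (nhds y)) (t : ℕ) :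
    Filter.Tendsto (fun j => scalarGain x (u j) t) Filter.atTop (nhds (scalarGain x y t)) := by
  cases t with
  | zero => exact tendsto_const_nhds
  | succ t => exact hu.smul_const 1

end LQGame
/-- the outer-loop objective `K ↦ G(K, L(K))` can be nonconvex and noncoercive
on the admissible set `𝒦`. -/
theorem LQGame.outer_landscape_nonconvex_noncoercive :
    ∃ (m d n N : ℕ) (g : LQGame m d n N), 0 < N
      ∧ (∃ K1 K2 : ℕ → Matrix (Fin d) (Fin m) ℝ,
          g.Admissible K1 ∧ g.Admissible K2
          ∧ g.Admissible (fun t => (1/2 : ℝ) • (K1 t + K2 t))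
          ∧ g.value K1 (g.Lopt K1) + g.value K2 (g.Lopt K2)
              < 2 * g.value (fun t => (1/2 : ℝ) • (K1 t + K2 t))
                  (g.Lopt (fun t => (1/2 : ℝ) • (K1 t + K2 t))))
      ∧ (∃ (Kj : ℕ → ℕ → Matrix (Fin d) (Fin m) ℝ) (Kbar : ℕ → Matrix (Fin d) (Fin m) ℝ),
          (∀ j : ℕ, g.Admissible (Kj j))
          ∧ ¬ g.Admissible Kbar
          ∧ (∀ t < N, Filter.Tendsto (fun j => Kj j t) Filter.atTop (nhds (Kbar t)))
          ∧ ∃ C : ℝ, ∀ j : ℕ, g.value (Kj j) (g.Lopt (Kj j)) ≤ C) := by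
  have hu : ∀ j : ℕ, (10 * ((j : ℝ) / (j + 1))) ^ 2 / 100 < 1 := fun j => by
    have hlt : (j : ℝ) / (j + 1) < 1 := by
      rw [div_lt_one (by positivity)]; linarith
    have hnonneg : 0 ≤ (j : ℝ) / (j + 1) := by positivity
    nlinarith
  refine ⟨1, 1, 1, 2, scalarGame, two_pos,
    ⟨scalarGain (-9) 0, scalarGain 1 5, ?_, ?_, ?_, ?_⟩,
    fun j => scalarGain 1 (10 * ((j : ℝ) / (j + 1))), scalarGain 1 10,
    fun j => (admissible_scalarGain_iff _ _).mpr (hu j), ?_, ?_, 2, fun j => ?_⟩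
  · rw [admissible_scalarGain_iff]; norm_num
  · rw [admissible_scalarGain_iff]; norm_num
  · rw [half_smul_scalarGain_add, admissible_scalarGain_iff]; norm_num
  · rw [half_smul_scalarGain_add, value_scalarGain (by norm_num), value_scalarGain (by norm_num),
      value_scalarGain (by norm_num)]
    norm_num
  · rw [admissible_scalarGain_iff]; norm_num
  · intro t _
    refine tendsto_scalarGain 1 ?_ t
    simpa using (tendsto_natCast_div_add_atTop (1 : ℝ)).const_mul 10
  · rw [value_scalarGain (hu j)]
    linarith [hu j]
end
end

section
/- (Uniform safe perturbation / openness of the admissible set.) For every K̲ ∈ 𝒦 there exists B₂ > 0 such that for every K ∈ 𝒦 satisfying P^K_t ⪯ P^{K̲}_t for all t ∈ {0,…,N}, and every gain K' with ‖K' − K‖_F ≤ B₂, one has K' ∈ 𝒦. In particular, 𝒦 is an open subset of (ℝ^{d×m})^N. -/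
open Matrix

noncomputable section

/-- Positive definiteness is an open condition among Hermitian matrices. -/
theorem Matrix.PosDef.eventually_of_isHermitian {a : ℕ} {M : Matrix (Fin a) (Fin a) ℝ}
    (hM : M.PosDef) :
    ∀ᶠ M' in nhds M, M'.IsHermitian → M'.PosDef := by
  have hcont : Continuous fun p : Matrix (Fin a) (Fin a) ℝ × (Fin a → ℝ) =>
      p.2 ⬝ᵥ p.1 *ᵥ p.2 :=
    continuous_snd.dotProduct (continuous_fst.matrix_mulVec continuous_snd)
  have hsphere : ∀ᶠ M' in nhds M, ∀ x ∈ Metric.sphere (0 : Fin a → ℝ) 1,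
      0 < x ⬝ᵥ M' *ᵥ x := by
    refine (isCompact_sphere _ _).eventually_forall_of_forall_eventually fun x hx => ?_
    refine hcont.continuousAt.eventually (lt_mem_nhds ?_)
    have hx0 : x ≠ 0 := ne_zero_of_mem_unit_sphere ⟨x, hx⟩
    simpa using hM.dotProduct_mulVec_pos hx0
  filter_upwards [hsphere] with M' hM' hherm
  refine .of_dotProduct_mulVec_pos hherm fun x hx => ?_
  have hnorm : 0 < ‖x‖ := norm_pos_iff.mpr hx
  have hpos := hM' (‖x‖⁻¹ • x) (by simp [norm_smul, hnorm.ne'])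
  rw [mulVec_smul, smul_dotProduct, dotProduct_smul, smul_eq_mul, smul_eq_mul] at hpos
  simpa using pos_of_mul_pos_right (pos_of_mul_pos_right hpos (by positivity)) (by positivity)

/-- Positive definite quadratic forms are coercive. -/
theorem Matrix.PosDef.exists_mul_sq_norm_le {a : ℕ} {M : Matrix (Fin a) (Fin a) ℝ}
    (hM : M.PosDef) :
    ∃ c : ℝ, 0 < c ∧ ∀ x : Fin a → ℝ, c * ‖x‖ ^ 2 ≤ x ⬝ᵥ M *ᵥ x := by
  have hcont : Continuous fun x : Fin a → ℝ => x ⬝ᵥ M *ᵥ x :=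
    continuous_id.dotProduct (continuous_const.matrix_mulVec continuous_id)
  obtain ⟨c, hc, hcle⟩ : ∃ c : ℝ, 0 < c ∧
      ∀ x ∈ Metric.sphere (0 : Fin a → ℝ) 1, c ≤ x ⬝ᵥ M *ᵥ x := by
    refine (isCompact_sphere _ _).exists_forall_le' hcont.continuousOn fun x hx => ?_
    have hx0 : x ≠ 0 := ne_zero_of_mem_unit_sphere ⟨x, hx⟩
    simpa using hM.dotProduct_mulVec_pos hx0
  refine ⟨c, hc, fun x => ?_⟩
  rcases eq_or_ne x 0 with rfl | hx
  · simp
  have hnorm : 0 < ‖x‖ := norm_pos_iff.mpr hx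
  have hle := hcle (‖x‖⁻¹ • x) (by simp [norm_smul, hnorm.ne'])
  rw [mulVec_smul, smul_dotProduct, dotProduct_smul, smul_eq_mul, smul_eq_mul] at hle
  calc c * ‖x‖ ^ 2 ≤ (‖x‖⁻¹ * (‖x‖⁻¹ * (x ⬝ᵥ M *ᵥ x))) * ‖x‖ ^ 2 := by gcongr
    _ = x ⬝ᵥ M *ᵥ x := by field_simp

theorem Matrix.isClosed_setOf_posSemidef {a : ℕ} :
    IsClosed {M : Matrix (Fin a) (Fin a) ℝ | M.PosSemidef} := by
  simp only [posSemidef_iff_dotProduct_mulVec, Set.ofPred_and, Set.ofPred_forall]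
  refine (isClosed_eq continuous_id.matrix_conjTranspose continuous_id).inter
    (isClosed_iInter fun x => isClosed_le continuous_const ?_)
  exact continuous_const.dotProduct (continuous_id.matrix_mulVec continuous_const)

theorem continuous_padZero {α : Type*} [Zero α] [TopologicalSpace α] {N : ℕ} :
    Continuous (padZero : (Fin N → α) → ℕ → α) := by
  refine continuous_pi fun t => ?_
  by_cases h : t < N
  · simpa [padZero, h] using continuous_apply (⟨t, h⟩ : Fin N)
  · simpa [padZero, h] using continuous_const

theorem abs_apply_le_sqrt_sum_frobNormSq {a b N : ℕ} (M : ℕ → Matrix (Fin a) (Fin b) ℝ)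
    {t : ℕ} (ht : t < N) (i : Fin a) (j : Fin b) :
    |M t i j| ≤ Real.sqrt (∑ s ∈ Finset.range N, frobNormSq (M s)) := by
  refine Real.abs_le_sqrt ?_
  calc (M t i j) ^ 2 ≤ ∑ l, (M t i l) ^ 2 :=
        Finset.single_le_sum (f := fun l => (M t i l) ^ 2) (fun _ _ => sq_nonneg _)
          (Finset.mem_univ j)
    _ ≤ frobNormSq (M t) :=
        Finset.single_le_sum (f := fun k => ∑ l, (M t k l) ^ 2)
          (fun _ _ => Finset.sum_nonneg fun _ _ => sq_nonneg _) (Finset.mem_univ i)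
    _ ≤ _ :=
        Finset.single_le_sum (f := fun s => frobNormSq (M s))
          (fun _ _ => Finset.sum_nonneg fun _ _ => Finset.sum_nonneg fun _ _ => sq_nonneg _)
          (Finset.mem_range.mpr ht)

namespace LQGame

variable {m d n N : ℕ}

/-- The matrix `R^w_t - D_tᵀ P^K_{t+1} D_t`, indexed by `j = N - (t + 1)`. -/
def HKaux (g : LQGame m d n N) (K : ℕ → Matrix (Fin d) (Fin m) ℝ) (j : ℕ) :
    Matrix (Fin n) (Fin n) ℝ :=
  g.Rw (N - (j+1)) - (g.D (N - (j+1)))ᵀ * g.PKaux K j * g.D (N - (j+1))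

theorem admissible_iff_HKaux (g : LQGame m d n N) (K : ℕ → Matrix (Fin d) (Fin m) ℝ) :
    g.Admissible K ↔ ∀ j < N, (g.HKaux K j).PosDef := by
  constructor
  · intro h j hj
    have hj' := h (N - (j + 1)) (by omega)
    rwa [PK, show N - (N - (j + 1) + 1) = j by omega] at hj'
  · intro h t ht
    have ht' := h (N - (t + 1)) (by omega)
    rwa [HKaux, show N - (N - (t + 1) + 1) = t by omega] at ht'

theorem PKaux_congr (g : LQGame m d n N) {K K' : ℕ → Matrix (Fin d) (Fin m) ℝ}
    (h : ∀ t < N, K t = K' t) : ∀ j ≤ N, g.PKaux K j = g.PKaux K' j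
  | 0, _ => rfl
  | j + 1, hj => by
      rw [PKaux, PKaux, PKaux_congr g h j (by omega), h (N - (j + 1)) (by omega)]

theorem admissible_congr (g : LQGame m d n N) {K K' : ℕ → Matrix (Fin d) (Fin m) ℝ}
    (h : ∀ t < N, K t = K' t) : g.Admissible K ↔ g.Admissible K' := by
  simp only [admissible_iff_HKaux, HKaux]
  exact forall₂_congr fun j hj => by rw [g.PKaux_congr h j hj.le]

theorem PKaux_isHermitian (g : LQGame m d n N) (K : ℕ → Matrix (Fin d) (Fin m) ℝ) :
    ∀ j ≤ N, (g.PKaux K j).IsHermitian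
  | 0, _ => g.hQN.isHermitian
  | j + 1, hj => by
      have ih := PKaux_isHermitian g K j (by omega)
      have hQ := (g.hQ (N - (j + 1)) (by omega)).isHermitian
      have hRu := (g.hRu (N - (j + 1)) (by omega)).isHermitian
      have hRw := (g.hRw (N - (j + 1)) (by omega)).isHermitian
      simp only [IsHermitian, conjTranspose_eq_transpose_of_trivial] at ih hQ hRu hRw ⊢
      simp [PKaux, transpose_mul, transpose_nonsing_inv, ih, hQ, hRu, hRw, Matrix.mul_assoc]

theorem HKaux_isHermitian (g : LQGame m d n N) (K : ℕ → Matrix (Fin d) (Fin m) ℝ)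
    {j : ℕ} (hj : j < N) : (g.HKaux K j).IsHermitian := by
  refine (g.hRw _ (by omega)).isHermitian.sub ?_
  simpa using isHermitian_conjTranspose_mul_mul (g.D (N - (j + 1)))
    (g.PKaux_isHermitian K j hj.le)

/-- One step of the Riccati recursion dominates the cost `Kᵀ R^u K` of the gain. -/
theorem PKaux_succ_sub_posSemidef (g : LQGame m d n N) (K : ℕ → Matrix (Fin d) (Fin m) ℝ)
    {j : ℕ} (hj : j < N) (hP : (g.PKaux K j).PosSemidef) (hH : (g.HKaux K j).PosDef) :
    (g.PKaux K (j + 1) -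
      (K (N - (j+1)))ᵀ * g.Ru (N - (j+1)) * K (N - (j+1))).PosSemidef := by
  have hQ := g.hQ (N - (j + 1)) (by omega)
  have hPt := hP.add (hH.inv.posSemidef.conjTranspose_mul_mul_same
    ((g.D (N - (j + 1)))ᵀ * g.PKaux K j))
  have hsum := hQ.add (hPt.conjTranspose_mul_mul_same
    (g.A (N - (j + 1)) - g.B (N - (j + 1)) * K (N - (j + 1))))
  have hPsymm : (g.PKaux K j)ᵀ = g.PKaux K j := by simpa using hP.isHermitian.eq
  convert hsum using 1
  simp only [PKaux, HKaux, conjTranspose_eq_transpose_of_trivial, transpose_mul,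
    transpose_transpose, hPsymm, Matrix.mul_assoc]
  abel

theorem PKaux_posSemidef (g : LQGame m d n N) (K : ℕ → Matrix (Fin d) (Fin m) ℝ)
    (hK : ∀ j < N, (g.HKaux K j).PosDef) : ∀ j ≤ N, (g.PKaux K j).PosSemidef
  | 0, _ => g.hQN
  | j + 1, hj => by
      have hstep := g.PKaux_succ_sub_posSemidef K hj (PKaux_posSemidef g K hK j (by omega))
        (hK j hj)
      have hRu := (g.hRu (N - (j + 1)) (by omega)).posSemidef.conjTranspose_mul_mul_same
        (K (N - (j + 1)))
      simpa using hstep.add hRu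

/-- `P^K_t` depends continuously on the gain wherever the later inner problems are
strictly concave. -/
theorem continuousAt_PKaux (g : LQGame m d n N) (K : ℕ → Matrix (Fin d) (Fin m) ℝ) :
    ∀ j, (∀ i < j, (g.HKaux K i).PosDef) → ContinuousAt (fun K' => g.PKaux K' j) K := by
  intro j
  induction j with
  | zero => exact fun _ => continuousAt_const
  | succ j ih =>
      intro h
      have hP := ih fun i hi => h i (by omega)
      have hHcont : Continuous fun P : Matrix (Fin m) (Fin m) ℝ =>
          g.Rw (N - (j+1)) - (g.D (N - (j+1)))ᵀ * P * g.D (N - (j+1)) := by fun_prop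
      have hH : ContinuousAt (fun K' => g.HKaux K' j) K :=
        hHcont.continuousAt.comp hP
      have hdet : (g.HKaux K j).det ≠ 0 :=
        ((isUnit_iff_isUnit_det _).mp (h j (by omega)).isUnit).ne_zero
      have hinv : ContinuousAt (fun K' => (g.HKaux K' j)⁻¹) K := by
        refine ContinuousAt.comp (continuousAt_matrix_inv _ ?_) hH
        rw [Ring.inverse_eq_inv']
        exact continuousAt_inv₀ hdet
      have hstep : Continuous fun p : (ℕ → Matrix (Fin d) (Fin m) ℝ) ×
          Matrix (Fin m) (Fin m) ℝ × Matrix (Fin n) (Fin n) ℝ =>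
          g.Q (N - (j+1)) + (p.1 (N - (j+1)))ᵀ * g.Ru (N - (j+1)) * p.1 (N - (j+1))
            + (g.A (N - (j+1)) - g.B (N - (j+1)) * p.1 (N - (j+1)))ᵀ *
              (p.2.1 + p.2.1 * g.D (N - (j+1)) * p.2.2 * (g.D (N - (j+1)))ᵀ * p.2.1) *
              (g.A (N - (j+1)) - g.B (N - (j+1)) * p.1 (N - (j+1))) := by fun_prop
      have hcomp := hstep.continuousAt.comp (continuousAt_id.prodMk (hP.prodMk hinv))
      simpa only [Function.comp_def, PKaux, HKaux, id] using hcomp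

theorem isOpen_setOf_admissible (g : LQGame m d n N) : IsOpen {K | g.Admissible K} := by
  refine isOpen_iff_mem_nhds.mpr fun K hK => ?_
  rw [Set.mem_ofPred_eq, admissible_iff_HKaux] at hK
  have hev : ∀ j ∈ Set.Iio N, ∀ᶠ K' in nhds K, (g.HKaux K' j).PosDef := by
    intro j hj
    have hHcont : Continuous fun P : Matrix (Fin m) (Fin m) ℝ =>
        g.Rw (N - (j+1)) - (g.D (N - (j+1)))ᵀ * P * g.D (N - (j+1)) := by fun_prop
    have hH : ContinuousAt (fun K' => g.HKaux K' j) K :=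
      hHcont.continuousAt.comp (g.continuousAt_PKaux K j fun i hi => hK i (hi.trans hj))
    filter_upwards [hH.eventually (hK j hj).eventually_of_isHermitian] with K' hK'
    exact hK' (g.HKaux_isHermitian K' hj)
  filter_upwards [(Set.finite_Iio N).eventually_all.mpr hev] with K' hK'
  exact (g.admissible_iff_HKaux K').mpr hK'

/-- Gains whose Riccati matrices are dominated by those of `Kl`. -/
def sublevel (g : LQGame m d n N) (Kl : ℕ → Matrix (Fin d) (Fin m) ℝ) :
    Set (ℕ → Matrix (Fin d) (Fin m) ℝ) :=
  {K | ∀ j ≤ N, (g.PKaux Kl j - g.PKaux K j).PosSemidef}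

theorem HKaux_posDef_of_le (g : LQGame m d n N) {K Kl : ℕ → Matrix (Fin d) (Fin m) ℝ} {j : ℕ}
    (hKl : (g.HKaux Kl j).PosDef) (h : (g.PKaux Kl j - g.PKaux K j).PosSemidef) :
    (g.HKaux K j).PosDef := by
  have hsum := hKl.add_posSemidef (h.conjTranspose_mul_mul_same (g.D (N - (j + 1))))
  convert hsum using 1
  simp only [HKaux, conjTranspose_eq_transpose_of_trivial, Matrix.mul_sub, Matrix.sub_mul]
  abel

theorem isClosed_sublevel (g : LQGame m d n N) {Kl : ℕ → Matrix (Fin d) (Fin m) ℝ}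
    (hKl : g.Admissible Kl) : IsClosed (g.sublevel Kl) := by
  rw [admissible_iff_HKaux] at hKl
  refine isClosed_of_closure_subset fun K hK j => ?_
  induction j using Nat.strong_induction_on with
  | _ j ih =>
    intro hj
    have hcont : ContinuousAt (fun K' => g.PKaux Kl j - g.PKaux K' j) K :=
      continuousAt_const.sub (g.continuousAt_PKaux K j fun i hi =>
        g.HKaux_posDef_of_le (hKl i (by omega)) (ih i hi (by omega)))
    have hmem := hcont.continuousWithinAt.mem_closure hK
      (t := {M : Matrix (Fin m) (Fin m) ℝ | M.PosSemidef}) fun K' hK' => hK' j hj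
    rwa [isClosed_setOf_posSemidef.closure_eq] at hmem

theorem exists_abs_le_of_mem_sublevel (g : LQGame m d n N)
    {Kl : ℕ → Matrix (Fin d) (Fin m) ℝ} (hKl : g.Admissible Kl) {t : ℕ} (ht : t < N) :
    ∃ C : ℝ, ∀ K ∈ g.sublevel Kl, ∀ k l, |K t k l| ≤ C := by
  rw [admissible_iff_HKaux] at hKl
  obtain ⟨j, hj, rfl⟩ : ∃ j < N, t = N - (j + 1) := ⟨N - (t + 1), by omega, by omega⟩
  obtain ⟨c, hc, hcle⟩ := (g.hRu _ ht).exists_mul_sq_norm_le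
  refine ⟨∑ l, Real.sqrt (g.PKaux Kl (j + 1) l l / c), fun K hK k l => ?_⟩
  have hH : ∀ i < N, (g.HKaux K i).PosDef := fun i hi =>
    g.HKaux_posDef_of_le (hKl i hi) (hK i hi.le)
  have hle := (hK (j + 1) hj).add
    (g.PKaux_succ_sub_posSemidef K hj (g.PKaux_posSemidef K hH j hj.le) (hH j hj))
  have hdiag := hle.diag_nonneg (i := l)
  have hquad := hcle fun i => K (N - (j + 1)) i l
  have hcoord := norm_le_pi_norm (fun i => K (N - (j + 1)) i l) k
  have hentry : ((K (N - (j + 1)))ᵀ * g.Ru (N - (j + 1)) * K (N - (j + 1))) l l =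
      (fun i => K (N - (j + 1)) i l) ⬝ᵥ
        g.Ru (N - (j + 1)) *ᵥ (fun i => K (N - (j + 1)) i l) := by
    rw [Matrix.mul_assoc]
    rfl
  rw [sub_add_sub_cancel, Matrix.sub_apply, hentry] at hdiag
  refine le_trans (Real.abs_le_sqrt ?_) (Finset.single_le_sum
    (f := fun l => Real.sqrt (g.PKaux Kl (j + 1) l l / c))
    (fun _ _ => Real.sqrt_nonneg _) (Finset.mem_univ l))
  rw [le_div_iff₀' hc]
  rw [Real.norm_eq_abs] at hcoord
  have hsq := pow_le_pow_left₀ (abs_nonneg _) hcoord 2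
  rw [sq_abs] at hsq
  nlinarith

/-- The admissible gains dominated by an admissible gain form a compact set of tuples. -/
theorem isCompact_preimage_sublevel (g : LQGame m d n N)
    {Kl : ℕ → Matrix (Fin d) (Fin m) ℝ} (hKl : g.Admissible Kl) :
    IsCompact {KF : Fin N → Fin d → Fin m → ℝ |
      padZero (α := Matrix (Fin d) (Fin m) ℝ) KF ∈ g.sublevel Kl} := by
  have hclosed : IsClosed {KF : Fin N → Fin d → Fin m → ℝ |
      padZero (α := Matrix (Fin d) (Fin m) ℝ) KF ∈ g.sublevel Kl} :=
    (g.isClosed_sublevel hKl).preimage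
      (continuous_padZero (α := Matrix (Fin d) (Fin m) ℝ) (N := N))
  choose C hC using fun t : Fin N => g.exists_abs_le_of_mem_sublevel hKl t.2
  refine (isCompact_univ_pi fun t => isCompact_univ_pi fun _ => isCompact_univ_pi fun _ =>
    isCompact_Icc (a := -C t) (b := C t)).of_isClosed_subset hclosed ?_
  intro KF hKF t _ i _ k _
  have hpad : padZero (α := Matrix (Fin d) (Fin m) ℝ) KF t = KF t := dif_pos t.2
  have hle := hC t _ hKF i k
  rw [hpad] at hle
  exact abs_le.mp hle

theorem isOpen_setOf_admissible_padZero (g : LQGame m d n N) :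
    IsOpen {KF : Fin N → Matrix (Fin d) (Fin m) ℝ | g.Admissible (padZero KF)} :=
  g.isOpen_setOf_admissible.preimage continuous_padZero

/-- Entrywise perturbations of uniformly small size preserve admissibility over the
sublevel set of an admissible gain. -/
theorem exists_forall_mem_sublevel_admissible (g : LQGame m d n N)
    {Kl : ℕ → Matrix (Fin d) (Fin m) ℝ} (hKl : g.Admissible Kl) :
    ∃ δ : ℝ, 0 < δ ∧ ∀ K ∈ g.sublevel Kl, ∀ K' : ℕ → Matrix (Fin d) (Fin m) ℝ,
      (∀ t < N, ∀ i k, |K' t i k - K t i k| ≤ δ) → g.Admissible K' := by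
  have hopen : IsOpen {KF : Fin N → Fin d → Fin m → ℝ |
      g.Admissible (padZero (α := Matrix (Fin d) (Fin m) ℝ) KF)} :=
    g.isOpen_setOf_admissible_padZero
  have hsubset : {KF : Fin N → Fin d → Fin m → ℝ |
        padZero (α := Matrix (Fin d) (Fin m) ℝ) KF ∈ g.sublevel Kl} ⊆
      {KF | g.Admissible (padZero (α := Matrix (Fin d) (Fin m) ℝ) KF)} := fun KF hKF =>
    (g.admissible_iff_HKaux _).mpr fun j hj =>
      g.HKaux_posDef_of_le ((g.admissible_iff_HKaux Kl).mp hKl j hj) (hKF j hj.le)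
  obtain ⟨δ, hδ, hthick⟩ :=
    (g.isCompact_preimage_sublevel hKl).exists_cthickening_subset_open hopen hsubset
  have hpad : ∀ K : ℕ → Matrix (Fin d) (Fin m) ℝ, ∀ t < N,
      padZero (fun s : Fin N => K s) t = K t := fun K t ht => dif_pos ht
  refine ⟨δ, hδ, fun K hK K' hdist => (g.admissible_congr (hpad K')).mp ?_⟩
  let KF : Fin N → Fin d → Fin m → ℝ := fun s => K s
  let KF' : Fin N → Fin d → Fin m → ℝ := fun s => K' s
  have hmem : KF ∈ {KF : Fin N → Fin d → Fin m → ℝ |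
      padZero (α := Matrix (Fin d) (Fin m) ℝ) KF ∈ g.sublevel Kl} := by
    intro j hj
    rw [g.PKaux_congr (hpad K) j hj]
    exact hK j hj
  have hclose : dist KF' KF ≤ δ := by
    simp only [dist_pi_le_iff hδ.le, Real.dist_eq]
    exact fun t i k => hdist t t.2 i k
  exact hthick (Metric.mem_cthickening_of_dist_le KF' KF δ _ hmem hclose)

end LQGame

/-- uniform safe perturbation radius on Loewner-sublevel subsets of `𝒦`,
and openness of the admissible set. -/
theorem LQGame.admissible_uniform_safe_perturbation {m d n N : ℕ} (g : LQGame m d n N) :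
    (∀ Kl : ℕ → Matrix (Fin d) (Fin m) ℝ, g.Admissible Kl →
      ∃ B2 : ℝ, 0 < B2 ∧
        ∀ K : ℕ → Matrix (Fin d) (Fin m) ℝ, g.Admissible K →
          (∀ t ≤ N, (g.PK Kl t - g.PK K t).PosSemidef) →
          ∀ K' : ℕ → Matrix (Fin d) (Fin m) ℝ,
            Real.sqrt (∑ t ∈ Finset.range N, frobNormSq (K' t - K t)) ≤ B2 →
            g.Admissible K')
    ∧ IsOpen {KF : Fin N → Matrix (Fin d) (Fin m) ℝ | g.Admissible (padZero KF)} := by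
  refine ⟨fun Kl hKl => ?_, g.isOpen_setOf_admissible_padZero⟩
  obtain ⟨δ, hδ, hadm⟩ := g.exists_forall_mem_sublevel_admissible hKl
  refine ⟨δ, hδ, fun K _ hle K' hdist => hadm K (fun j hj => ?_) K' fun t ht i k => ?_⟩
  · have hlej := hle (N - j) (by omega)
    rwa [PK, PK, show N - (N - j) = j by omega] at hlej
  · exact (abs_apply_le_sqrt_sum_frobNormSq (fun s => K' s - K s) ht i k).trans hdist
end
end

section
/- (Compactness of the regularized admissible set.) Let K⁰ ∈ 𝒦 with ζ := min_{0≤t≤N−1} λ_min(R^w_t − D_tᵀP^{K⁰}_{t+1}D_t) > 0, and suppose max_{0≤t≤N−1} ‖D_t‖ > 0. Define 𝒦̂ := { K ∈ 𝒦 : P^K_t ⪯ P^{K⁰}_t + (ζ / (2 max_{0≤t≤N−1} ‖D_t‖²)) I for all t ∈ {0,…,N} }. Then 𝒦̂ is a compact subset of (ℝ^{d×m})^N, and every K ∈ 𝒦̂ satisfies λ_min(R^w_t − D_tᵀP^K_{t+1}D_t) ≥ ζ/2 for every t ∈ {0,…,N−1}. -/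
open Matrix

noncomputable section

open Topology

section Rayleigh

variable {a b : ℕ}

theorem isCompact_dotProduct_self_eq_one : IsCompact {x : Fin a → ℝ | x ⬝ᵥ x = 1} := by
  refine (isCompact_Icc (a := (-1 : Fin a → ℝ)) (b := 1)).of_isClosed_subset
    (isClosed_eq (by fun_prop) continuous_const) fun x hx => ?_
  have h (i : Fin a) : |x i| ≤ 1 := by
    rw [← sq_le_one_iff_abs_le_one, ← (hx : x ⬝ᵥ x = 1), sq]
    exact Finset.single_le_sum (f := fun i => x i * x i) (fun j _ => mul_self_nonneg (x j))
      (Finset.mem_univ i)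
  exact ⟨fun i => (abs_le.mp (h i)).1, fun i => (abs_le.mp (h i)).2⟩

theorem isCompact_rayleighSet (M : Matrix (Fin a) (Fin a) ℝ) : IsCompact (rayleighSet M) := by
  have h := isCompact_dotProduct_self_eq_one.image
    (f := fun x : Fin a → ℝ => x ⬝ᵥ M *ᵥ x) (by fun_prop)
  convert h using 1
  ext r
  simp [rayleighSet, eq_comm]

theorem rayleighSet_nonempty (ha : 0 < a) (M : Matrix (Fin a) (Fin a) ℝ) :
    (rayleighSet M).Nonempty :=
  ⟨_, Pi.single ⟨0, ha⟩ 1, by simp, rfl⟩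

theorem eigMin_le {M : Matrix (Fin a) (Fin a) ℝ} {x : Fin a → ℝ} (hx : x ⬝ᵥ x = 1) :
    eigMin M ≤ x ⬝ᵥ M *ᵥ x :=
  csInf_le (isCompact_rayleighSet M).bddBelow ⟨x, hx, rfl⟩

theorem le_eigMax {M : Matrix (Fin a) (Fin a) ℝ} {x : Fin a → ℝ} (hx : x ⬝ᵥ x = 1) :
    x ⬝ᵥ M *ᵥ x ≤ eigMax M :=
  le_csSup (isCompact_rayleighSet M).bddAbove ⟨x, hx, rfl⟩

theorem eigMin_mul_dotProduct_self_le (M : Matrix (Fin a) (Fin a) ℝ) (x : Fin a → ℝ) :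
    eigMin M * (x ⬝ᵥ x) ≤ x ⬝ᵥ M *ᵥ x := by
  by_cases hx : x = 0
  · simp [hx]
  have hpos : 0 < x ⬝ᵥ x :=
    (Finset.sum_nonneg fun i _ => mul_self_nonneg (x i)).lt_of_ne'
      (fun h => hx (dotProduct_self_eq_zero.mp h))
  have hs : √(x ⬝ᵥ x) * √(x ⬝ᵥ x) = x ⬝ᵥ x := Real.mul_self_sqrt hpos.le
  have hs0 : √(x ⬝ᵥ x) ≠ 0 := (Real.sqrt_pos.mpr hpos).ne'
  have h := eigMin_le (M := M) (x := (√(x ⬝ᵥ x))⁻¹ • x) (by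
    simp only [smul_dotProduct, dotProduct_smul, smul_eq_mul]
    field_simp
    rw [sq, hs])
  simp only [mulVec_smul, smul_dotProduct, dotProduct_smul, smul_eq_mul] at h
  rw [← mul_assoc, ← mul_inv, hs, inv_mul_eq_div, le_div_iff₀ hpos] at h
  exact h

theorem eigMin_pos (ha : 0 < a) {M : Matrix (Fin a) (Fin a) ℝ} (hM : M.PosDef) :
    0 < eigMin M := by
  obtain ⟨x, hx, h⟩ := (isCompact_rayleighSet M).sInf_mem (rayleighSet_nonempty ha M)
  rw [eigMin, h]
  refine hM.dotProduct_mulVec_pos (x := x) ?_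
  rintro rfl
  simp at hx

theorem Matrix.PosDef.exists_pos_mul_dotProduct_self_le {M : Matrix (Fin a) (Fin a) ℝ}
    (hM : M.PosDef) : ∃ r > 0, ∀ x : Fin a → ℝ, r * (x ⬝ᵥ x) ≤ x ⬝ᵥ M *ᵥ x := by
  rcases Nat.eq_zero_or_pos a with rfl | ha
  · exact ⟨1, one_pos, fun x => by simp [dotProduct]⟩
  · exact ⟨eigMin M, eigMin_pos ha hM, eigMin_mul_dotProduct_self_le M⟩

theorem dotProduct_mulVec_self_le_opNorm_sq (D : Matrix (Fin a) (Fin b) ℝ) {x : Fin b → ℝ}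
    (hx : x ⬝ᵥ x = 1) : (D *ᵥ x) ⬝ᵥ (D *ᵥ x) ≤ opNorm D ^ 2 := by
  have h : (D *ᵥ x) ⬝ᵥ (D *ᵥ x) ≤ eigMax (Dᵀ * D) := by
    have := le_eigMax (M := Dᵀ * D) hx
    rwa [← mulVec_mulVec, dotProduct_mulVec x, vecMul_transpose] at this
  have h0 : 0 ≤ (D *ᵥ x) ⬝ᵥ (D *ᵥ x) := Finset.sum_nonneg fun i _ => mul_self_nonneg _
  rwa [opNorm, Real.sq_sqrt (h0.trans h)]

theorem pos_of_opNorm_pos {D : Matrix (Fin a) (Fin b) ℝ} (hD : 0 < opNorm D) : 0 < b := by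
  rcases Nat.eq_zero_or_pos b with rfl | hb
  · simp [opNorm, eigMax, rayleighSet, dotProduct] at hD
  · exact hb

end Rayleigh

namespace Matrix

variable {ι : Type*} [Fintype ι]

theorem isClosed_setOf_posSemidef_s17 : IsClosed {M : Matrix ι ι ℝ | M.PosSemidef} := by
  simp only [posSemidef_iff_dotProduct_mulVec, Set.ofPred_and, Set.ofPred_forall]
  exact (isClosed_eq (by fun_prop) continuous_id).inter
    (isClosed_iInter fun x => isClosed_le continuous_const (by fun_prop))

theorem PosDef.continuousAt_inv [DecidableEq ι] {M : Matrix ι ι ℝ} (hM : M.PosDef) :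
    ContinuousAt Inv.inv M := by
  refine continuousAt_matrix_inv M ?_
  rw [Ring.inverse_eq_inv']
  exact continuousAt_inv₀ hM.det_pos.ne'

end Matrix

namespace LQGame

variable {m d n N : ℕ} (g : LQGame m d n N)

theorem PK_terminal (K : ℕ → Matrix (Fin d) (Fin m) ℝ) : g.PK K N = g.QN := by
  simp [PK, PKaux]

theorem PK_of_lt (K : ℕ → Matrix (Fin d) (Fin m) ℝ) {t : ℕ} (ht : t < N) :
    g.PK K t = g.Q t + (K t)ᵀ * g.Ru t * K t
      + (g.A t - g.B t * K t)ᵀ * g.Ptilde K t * (g.A t - g.B t * K t) := by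
  have h1 : N - t = (N - (t + 1)) + 1 := by omega
  have h2 : N - ((N - (t + 1)) + 1) = t := by omega
  rw [PK, h1, PKaux, h2]
  rfl

variable {g}

theorem posSemidef_Ptilde {K : ℕ → Matrix (Fin d) (Fin m) ℝ} {t : ℕ}
    (hP : (g.PK K (t + 1)).PosSemidef)
    (hM : (g.Rw t - (g.D t)ᵀ * g.PK K (t + 1) * g.D t).PosDef) :
    (g.Ptilde K t).PosSemidef := by
  have h := hM.inv.posSemidef.mul_mul_conjTranspose_same (g.PK K (t + 1) * g.D t)
  rw [conjTranspose_mul, hP.isHermitian.eq, conjTranspose_eq_transpose_of_trivial,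
    ← Matrix.mul_assoc] at h
  exact hP.add h

theorem Admissible.posSemidef_PK {K : ℕ → Matrix (Fin d) (Fin m) ℝ} (hK : g.Admissible K)
    {t : ℕ} (ht : t ≤ N) : (g.PK K t).PosSemidef := by
  induction ht using Nat.decreasingInduction with
  | self => rw [PK_terminal]; exact g.hQN
  | of_succ t ht ih =>
    rw [PK_of_lt g K ht]
    exact ((g.hQ t ht).add ((g.hRu t ht).posSemidef.conjTranspose_mul_mul_same (K t))).add
      ((posSemidef_Ptilde ih (hK t ht)).conjTranspose_mul_mul_same (g.A t - g.B t * K t))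

theorem Admissible.gain_diag_le_PK_diag {K : ℕ → Matrix (Fin d) (Fin m) ℝ}
    (hK : g.Admissible K) {t : ℕ} (ht : t < N) (j : Fin m) :
    (K t).col j ⬝ᵥ g.Ru t *ᵥ (K t).col j ≤ g.PK K t j j := by
  have h := ((g.hQ t ht).add ((posSemidef_Ptilde (hK.posSemidef_PK ht)
    (hK t ht)).conjTranspose_mul_mul_same (g.A t - g.B t * K t))).diag_nonneg (i := j)
  have e : (K t).col j ⬝ᵥ g.Ru t *ᵥ (K t).col j = ((K t)ᵀ * g.Ru t * K t) j j := by
    rw [Matrix.mul_assoc]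
    rfl
  rw [PK_of_lt g K ht, e]
  simp only [conjTranspose_eq_transpose_of_trivial, Matrix.add_apply] at h ⊢
  linarith

/-- If `P ⪯ P₀ + c I`, then the quadratic form of `R - Dᵀ P D` is at least that of `R - Dᵀ P₀ D`
minus `c ‖D x‖²`. -/
theorem le_dotProduct_mulVec_of_posSemidef {R : Matrix (Fin n) (Fin n) ℝ}
    {D : Matrix (Fin m) (Fin n) ℝ} {P₀ P : Matrix (Fin m) (Fin m) ℝ} {c : ℝ}
    (h : (P₀ + c • (1 : Matrix (Fin m) (Fin m) ℝ) - P).PosSemidef) (x : Fin n → ℝ) :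
    x ⬝ᵥ (R - Dᵀ * P₀ * D) *ᵥ x - c * ((D *ᵥ x) ⬝ᵥ (D *ᵥ x)) ≤
      x ⬝ᵥ (R - Dᵀ * P * D) *ᵥ x := by
  have e (S : Matrix (Fin m) (Fin m) ℝ) :
      x ⬝ᵥ (Dᵀ * S * D) *ᵥ x = (D *ᵥ x) ⬝ᵥ S *ᵥ (D *ᵥ x) := by
    rw [← mulVec_mulVec, ← mulVec_mulVec, dotProduct_mulVec x, vecMul_transpose]
  have h' := h.dotProduct_mulVec_nonneg (D *ᵥ x)
  simp only [star_trivial, sub_mulVec, add_mulVec, smul_mulVec, one_mulVec, dotProduct_sub,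
    dotProduct_add, dotProduct_smul, smul_eq_mul, e] at h' ⊢
  linarith

theorem continuous_padZero_apply (t : ℕ) :
    Continuous fun KF : Fin N → Matrix (Fin d) (Fin m) ℝ => padZero KF t := by
  unfold padZero
  split_ifs
  · exact continuous_apply _
  · exact continuous_const

/-- The Riccati matrix at time `t` depends continuously on the gain, relative to `S`, if the one
at time `t + 1` does and the admissibility condition at time `t` holds at the given point. -/
theorem continuousWithinAt_PK_of_succ {S : Set (Fin N → Matrix (Fin d) (Fin m) ℝ)}
    {KF : Fin N → Matrix (Fin d) (Fin m) ℝ} {t : ℕ} (ht : t < N)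
    (hP : ContinuousWithinAt (fun KF => g.PK (padZero KF) (t + 1)) S KF)
    (hM : (g.Rw t - (g.D t)ᵀ * g.PK (padZero KF) (t + 1) * g.D t).PosDef) :
    ContinuousWithinAt (fun KF => g.PK (padZero KF) t) S KF := by
  have hinv : ContinuousWithinAt
      (fun KF => (g.Rw t - (g.D t)ᵀ * g.PK (padZero KF) (t + 1) * g.D t)⁻¹) S KF := by
    have hc : Continuous fun P : Matrix (Fin m) (Fin m) ℝ => g.Rw t - (g.D t)ᵀ * P * g.D t := by
      fun_prop
    exact ContinuousAt.comp_continuousWithinAt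
      (f := fun KF => g.Rw t - (g.D t)ᵀ * g.PK (padZero KF) (t + 1) * g.D t)
      hM.continuousAt_inv (hc.continuousAt.comp_continuousWithinAt hP)
  have hφ : Continuous fun p : Matrix (Fin m) (Fin m) ℝ × Matrix (Fin n) (Fin n) ℝ ×
      Matrix (Fin d) (Fin m) ℝ =>
      g.Q t + p.2.2ᵀ * g.Ru t * p.2.2 + (g.A t - g.B t * p.2.2)ᵀ *
        (p.1 + p.1 * g.D t * p.2.1 * (g.D t)ᵀ * p.1) * (g.A t - g.B t * p.2.2) := by
    fun_prop
  have h := hφ.continuousAt.comp_continuousWithinAt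
    (hP.prodMk (hinv.prodMk (continuous_padZero_apply t).continuousWithinAt))
  simp only [PK_of_lt g _ ht]
  exact h

theorem isClosed_setOf_admissible_posSemidef (U : ℕ → Matrix (Fin m) (Fin m) ℝ) {δ : ℝ}
    (hδ : 0 < δ)
    (hmargin : ∀ K, g.Admissible K → (∀ t ≤ N, (U t - g.PK K t).PosSemidef) → ∀ t < N,
      (g.Rw t - (g.D t)ᵀ * g.PK K (t + 1) * g.D t
        - δ • (1 : Matrix (Fin n) (Fin n) ℝ)).PosSemidef) :
    IsClosed {KF : Fin N → Matrix (Fin d) (Fin m) ℝ | g.Admissible (padZero KF) ∧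
      ∀ t ≤ N, (U t - g.PK (padZero KF) t).PosSemidef} := by
  set S := {KF : Fin N → Matrix (Fin d) (Fin m) ℝ | g.Admissible (padZero KF) ∧
      ∀ t ≤ N, (U t - g.PK (padZero KF) t).PosSemidef}
  refine isClosed_of_closure_subset fun KF hKF => ?_
  have : (𝓝[S] KF).NeBot := mem_closure_iff_nhdsWithin_neBot.mp hKF
  have hpd {t : ℕ} (ht : t < N)
      (hP : ContinuousWithinAt (fun KF => g.PK (padZero KF) (t + 1)) S KF) :
      (g.Rw t - (g.D t)ᵀ * g.PK (padZero KF) (t + 1) * g.D t).PosDef := by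
    have hc : Continuous fun P : Matrix (Fin m) (Fin m) ℝ =>
        g.Rw t - (g.D t)ᵀ * P * g.D t - δ • (1 : Matrix (Fin n) (Fin n) ℝ) := by
      fun_prop
    have hlim := isClosed_setOf_posSemidef_s17.mem_of_tendsto
      (hc.continuousAt.comp_continuousWithinAt hP)
      (eventually_nhdsWithin_of_forall fun K hK => hmargin (padZero K) hK.1 hK.2 t ht)
    have := (PosDef.one.smul hδ).posSemidef_add hlim
    simpa using this
  have hcont {t : ℕ} (ht : t ≤ N) :
      ContinuousWithinAt (fun KF => g.PK (padZero KF) t) S KF := by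
    induction ht using Nat.decreasingInduction with
    | self => simpa only [PK_terminal] using continuousWithinAt_const
    | of_succ t ht ih => exact continuousWithinAt_PK_of_succ ht ih (hpd ht ih)
  refine ⟨fun t ht => hpd ht (hcont ht), fun t ht => ?_⟩
  have hsub : ContinuousWithinAt (fun KF => U t - g.PK (padZero KF) t) S KF :=
    continuousWithinAt_const.sub (hcont ht)
  exact isClosed_setOf_posSemidef_s17.mem_of_tendsto hsub
    (eventually_nhdsWithin_of_forall fun K hK => hK.2 t ht)

theorem exists_isCompact_superset_setOf_admissible_posSemidef
    (U : ℕ → Matrix (Fin m) (Fin m) ℝ) :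
    ∃ C : Set (Fin N → Matrix (Fin d) (Fin m) ℝ), IsCompact C ∧
      {KF : Fin N → Matrix (Fin d) (Fin m) ℝ | g.Admissible (padZero KF) ∧
        ∀ t ≤ N, (U t - g.PK (padZero KF) t).PosSemidef} ⊆ C := by
  choose r hr hrle using fun t : Fin N => (g.hRu t t.2).exists_pos_mul_dotProduct_self_le
  let b (t : Fin N) (j : Fin m) : ℝ := √(U t j j / r t)
  have hC : IsCompact (Set.univ.pi fun t : Fin N => Set.univ.pi fun _ : Fin d =>
      Set.univ.pi fun j : Fin m => Set.Icc (-b t j) (b t j)) :=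
    isCompact_univ_pi fun t => isCompact_univ_pi fun _ => isCompact_univ_pi fun j => isCompact_Icc
  refine ⟨_, hC, fun KF hKF t _ i _ j _ => abs_le.mp (Real.abs_le_sqrt ?_)⟩
  have hpad : padZero KF t = KF t := by simp [padZero]
  have hgain := hKF.1.gain_diag_le_PK_diag t.2 j
  rw [hpad] at hgain
  have hU := (hKF.2 t t.2.le).diag_nonneg (i := j)
  rw [Matrix.sub_apply] at hU
  have hentry : KF t i j ^ 2 ≤ (KF t).col j ⬝ᵥ (KF t).col j := by
    rw [sq]
    exact Finset.single_le_sum (f := fun i => KF t i j * KF t i j)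
      (fun k _ => mul_self_nonneg _) (Finset.mem_univ i)
  rw [le_div_iff₀' (hr t)]
  have := hrle t ((KF t).col j)
  have := mul_le_mul_of_nonneg_left hentry (hr t).le
  linarith

end LQGame

/-- compactness of the regularized admissible set `𝒦̂`, and the uniform
eigenvalue margin `ζ/2` on it. -/
theorem LQGame.regularized_admissible_compact {m d n N : ℕ} (g : LQGame m d n N)
    (hN : 0 < N) (K0 : ℕ → Matrix (Fin d) (Fin m) ℝ) (hK0 : g.Admissible K0)
    (hD : 0 < (Finset.range N).sup' (Finset.nonempty_range_iff.mpr hN.ne')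
      (fun t => opNorm (g.D t))) :
    let ζ := (Finset.range N).inf' (Finset.nonempty_range_iff.mpr hN.ne')
      (fun t => eigMin (g.Rw t - (g.D t)ᵀ * g.PK K0 (t+1) * g.D t))
    let maxD := (Finset.range N).sup' (Finset.nonempty_range_iff.mpr hN.ne')
      (fun t => opNorm (g.D t))
    IsCompact {KF : Fin N → Matrix (Fin d) (Fin m) ℝ |
        g.Admissible (padZero KF)
        ∧ ∀ t ≤ N, (g.PK K0 t + (ζ / (2 * maxD ^ 2)) • (1 : Matrix (Fin m) (Fin m) ℝ)
            - g.PK (padZero KF) t).PosSemidef}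
    ∧ ∀ K : ℕ → Matrix (Fin d) (Fin m) ℝ, g.Admissible K →
        (∀ t ≤ N, (g.PK K0 t + (ζ / (2 * maxD ^ 2)) • (1 : Matrix (Fin m) (Fin m) ℝ)
            - g.PK K t).PosSemidef) →
        ∀ t < N, ζ / 2 ≤ eigMin (g.Rw t - (g.D t)ᵀ * g.PK K (t+1) * g.D t) := by
  intro ζ maxD
  obtain ⟨s, -, hs⟩ := (Finset.lt_sup'_iff _).mp hD
  have hn : 0 < n := pos_of_opNorm_pos hs
  have hζ : 0 < ζ :=
    (Finset.lt_inf'_iff _).mpr fun t ht => eigMin_pos hn (hK0 t (Finset.mem_range.mp ht))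
  have hmargin (K : ℕ → Matrix (Fin d) (Fin m) ℝ)
      (hU : ∀ t ≤ N, (g.PK K0 t + (ζ / (2 * maxD ^ 2)) • (1 : Matrix (Fin m) (Fin m) ℝ)
        - g.PK K t).PosSemidef) (t : ℕ) (ht : t < N) :
      ζ / 2 ≤ eigMin (g.Rw t - (g.D t)ᵀ * g.PK K (t + 1) * g.D t) := by
    refine le_csInf (rayleighSet_nonempty hn _) ?_
    rintro _ ⟨x, hx, rfl⟩
    have h0 : ζ ≤ x ⬝ᵥ (g.Rw t - (g.D t)ᵀ * g.PK K0 (t + 1) * g.D t) *ᵥ x :=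
      (Finset.inf'_le _ (Finset.mem_range.mpr ht)).trans (eigMin_le hx)
    have hDx : (g.D t *ᵥ x) ⬝ᵥ (g.D t *ᵥ x) ≤ maxD ^ 2 :=
      (dotProduct_mulVec_self_le_opNorm_sq (g.D t) hx).trans <|
        pow_le_pow_left₀ (Real.sqrt_nonneg _) (Finset.le_sup' (fun t => opNorm (g.D t))
          (Finset.mem_range.mpr ht)) 2
    have hmaxD : 0 < maxD := hD
    have hc : ζ / (2 * maxD ^ 2) * ((g.D t *ᵥ x) ⬝ᵥ (g.D t *ᵥ x)) ≤ ζ / 2 :=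
      (mul_le_mul_of_nonneg_left hDx (by positivity)).trans_eq (by field_simp)
    have := LQGame.le_dotProduct_mulVec_of_posSemidef (R := g.Rw t) (D := g.D t) (hU (t + 1) ht) x
    linarith
  refine ⟨?_, fun K _ hU => hmargin K hU⟩
  obtain ⟨C, hC, hsub⟩ := LQGame.exists_isCompact_superset_setOf_admissible_posSemidef (g := g)
    (fun t => g.PK K0 t + (ζ / (2 * maxD ^ 2)) • (1 : Matrix (Fin m) (Fin m) ℝ))
  refine hC.of_isClosed_subset ?_ hsub
  refine LQGame.isClosed_setOf_admissible_posSemidef _ (half_pos hζ) fun K hK hU t ht => ?_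
  refine .of_dotProduct_mulVec_nonneg
    ((hK t ht).isHermitian.sub (isHermitian_one.smul (by simp [IsSelfAdjoint]))) fun x => ?_
  have h := (mul_le_mul_of_nonneg_right (hmargin K hU t ht)
    (Finset.sum_nonneg fun i _ => mul_self_nonneg (x i))).trans
    (eigMin_mul_dotProduct_self_le _ x)
  rw [sub_mulVec, dotProduct_sub, smul_mulVec, one_mulVec, dotProduct_smul, smul_eq_mul,
    sub_nonneg]
  exact h
end
end

section
/- (Local Lipschitz continuity of the Riccati solution, inner maximizer, and covariance in the outer gain.) For every K ∈ 𝒦 there exist positive constants B₁, B_P, B_L, B_Σ (depending on K and the problem data) such that every K' ∈ 𝒦 with ‖K' − K‖_F ≤ B₁ satisfies, for all t: ‖P^{K'}_t − P^K_t‖_F ≤ B_P · ‖K' − K‖_F, ‖L(K')_t − L(K)_t‖_F ≤ B_L · ‖K' − K‖_F, and ‖X^{K',L(K')}_t − X^{K,L(K)}_t‖_F ≤ B_Σ · ‖K' − K‖_F. -/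
open Matrix

noncomputable section

section LipschitzAt

open Filter Topology Asymptotics

attribute [local instance] Matrix.frobeniusNormedAddCommGroup Matrix.frobeniusNormedSpace
  Matrix.frobeniusNormedRing Matrix.frobeniusNormedAlgebra

lemma frobNorm_eq_norm {a b : ℕ} (M : Matrix (Fin a) (Fin b) ℝ) : frobNorm M = ‖M‖ := by
  rw [Matrix.frobenius_norm_def, frobNorm, frobNormSq, Real.sqrt_eq_rpow]
  simp

/-- `f` is Lipschitz at the point `x₀`, measured by the gauge `δ`. -/
def LipschitzAtGauge {κ E : Type*} [NormedAddCommGroup E] (δ : κ → ℝ) (x₀ : κ) (f : κ → E) :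
    Prop :=
  (fun x => f x - f x₀) =O[comap δ (𝓝 0)] δ

namespace LipschitzAtGauge

variable {κ : Type*} {δ : κ → ℝ} {x₀ : κ} {a b c : ℕ}

lemma const {E : Type*} [NormedAddCommGroup E] (y : E) :
    LipschitzAtGauge δ x₀ (fun _ => y) := by
  simpa [LipschitzAtGauge] using isBigO_zero _ _

lemma add {E : Type*} [NormedAddCommGroup E] {f g : κ → E}
    (hf : LipschitzAtGauge δ x₀ f) (hg : LipschitzAtGauge δ x₀ g) :
    LipschitzAtGauge δ x₀ (fun x => f x + g x) := by
  refine (IsBigO.add hf hg).congr_left fun x => ?_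
  exact (add_sub_add_comm _ _ _ _).symm

lemma neg {E : Type*} [NormedAddCommGroup E] {f : κ → E}
    (hf : LipschitzAtGauge δ x₀ f) : LipschitzAtGauge δ x₀ (fun x => -f x) := by
  refine (IsBigO.neg_left hf).congr_left fun x => ?_
  exact neg_sub' _ _

lemma sub {E : Type*} [NormedAddCommGroup E] {f g : κ → E}
    (hf : LipschitzAtGauge δ x₀ f) (hg : LipschitzAtGauge δ x₀ g) :
    LipschitzAtGauge δ x₀ (fun x => f x - g x) := by
  simpa only [sub_eq_add_neg] using hf.add hg.neg

lemma tendsto {E : Type*} [NormedAddCommGroup E] {f : κ → E}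
    (hf : LipschitzAtGauge δ x₀ f) : Tendsto (fun x => f x - f x₀) (comap δ (𝓝 0)) (𝓝 0) :=
  IsBigO.trans_tendsto hf tendsto_comap

lemma transpose {f : κ → Matrix (Fin a) (Fin b) ℝ} (hf : LipschitzAtGauge δ x₀ f) :
    LipschitzAtGauge δ x₀ (fun x => (f x)ᵀ) := by
  refine (IsBigO.of_norm_left (hf.norm_left.congr_left fun x => ?_))
  rw [← Matrix.transpose_sub, Matrix.frobenius_norm_transpose]

lemma isBigO_matrix_mul {l : Filter κ} {f : κ → Matrix (Fin a) (Fin b) ℝ}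
    {g : κ → Matrix (Fin b) (Fin c) ℝ} {u v : κ → ℝ} (hf : f =O[l] u) (hg : g =O[l] v) :
    (fun x => f x * g x) =O[l] fun x => u x * v x := by
  refine IsBigO.trans (IsBigO.of_norm_le fun x => ?_) (hf.norm_left.mul hg.norm_left)
  exact Matrix.frobenius_norm_mul _ _

lemma mul {f : κ → Matrix (Fin a) (Fin b) ℝ} {g : κ → Matrix (Fin b) (Fin c) ℝ}
    (hf : LipschitzAtGauge δ x₀ f) (hg : LipschitzAtGauge δ x₀ g) :
    LipschitzAtGauge δ x₀ (fun x => f x * g x) := by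
  have hbdd : g =O[comap δ (𝓝 0)] (fun _ => (1 : ℝ)) := by
    have h : (fun x => (g x - g x₀) + g x₀) =O[comap δ (𝓝 0)] (fun _ => (1 : ℝ)) :=
      (hg.tendsto.isBigO_one ℝ).add (isBigO_const_const _ one_ne_zero _)
    simpa using h
  have h₁ := isBigO_matrix_mul hf hbdd
  have h₂ := isBigO_matrix_mul (isBigO_const_const (f x₀) (one_ne_zero (α := ℝ)) _) hg
  simp only [mul_one, one_mul] at h₁ h₂
  refine (h₁.add h₂).congr_left fun x => ?_
  rw [Matrix.sub_mul, Matrix.mul_sub]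
  abel

lemma inv {f : κ → Matrix (Fin a) (Fin a) ℝ} (hf : LipschitzAtGauge δ x₀ f)
    (hu : IsUnit (f x₀)) : LipschitzAtGauge δ x₀ (fun x => (f x)⁻¹) := by
  obtain ⟨u, hu⟩ := hu
  have : CompleteSpace (Matrix (Fin a) (Fin a) ℝ) := FiniteDimensional.complete ℝ _
  have h := (NormedRing.inverse_add_norm_diff_first_order u).comp_tendsto hf.tendsto
  refine (IsBigO.trans h hf.norm_left).congr_left fun x => ?_
  simp only [Function.comp_apply, Matrix.nonsing_inv_eq_ringInverse, hu, add_sub_cancel]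
  rw [← hu, Ring.inverse_unit]

/-- Finitely many maps that are Lipschitz at `x₀` admit a common constant and radius. -/
lemma exists_uniform_bound (hδ : ∀ x, 0 ≤ δ x) {f : ℕ → κ → Matrix (Fin a) (Fin b) ℝ}
    {s : Finset ℕ} (hf : ∀ t ∈ s, LipschitzAtGauge δ x₀ (f t)) :
    ∃ C > 0, ∃ r > 0, ∀ x, δ x ≤ r → ∀ t ∈ s, frobNorm (f t x - f t x₀) ≤ C * δ x := by
  have hsum : (fun x => ∑ t ∈ s, ‖f t x - f t x₀‖) =O[comap δ (𝓝 0)] δ :=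
    by
    simpa only [Finset.sum_fn] using IsBigO.sum fun t ht => (hf t ht).norm_left
  obtain ⟨C, hC, hbound⟩ := hsum.exists_pos
  obtain ⟨r, hr, hball⟩ := ((Metric.nhds_basis_closedBall.comap δ).eventually_iff).1 hbound.bound
  refine ⟨C, hC, r, hr, fun x hx t ht => ?_⟩
  have hx' := hball (x := x) (by simpa [abs_of_nonneg (hδ x)] using hx)
  rw [Real.norm_of_nonneg (hδ x), Real.norm_of_nonneg (by positivity)] at hx'
  rw [frobNorm_eq_norm]
  exact (Finset.single_le_sum (f := fun t => ‖f t x - f t x₀‖)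
    (fun _ _ => norm_nonneg _) ht).trans hx'

end LipschitzAtGauge

namespace LQGame

variable {m d n N : ℕ}

/-- Frobenius distance of two gain tuples over the horizon `N`. -/
def gainDist (N : ℕ) (K K' : ℕ → Matrix (Fin d) (Fin m) ℝ) : ℝ :=
  Real.sqrt (∑ t ∈ Finset.range N, frobNormSq (K' t - K t))

lemma lipschitzAt_gain (K : ℕ → Matrix (Fin d) (Fin m) ℝ) {t : ℕ} (ht : t < N) :
    LipschitzAtGauge (gainDist N K) K (fun K' => K' t) := by
  refine IsBigO.of_norm_le fun K' => ?_
  rw [← frobNorm_eq_norm]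
  refine Real.sqrt_le_sqrt (Finset.single_le_sum (f := fun t => frobNormSq (K' t - K t))
    (fun _ _ => ?_) (Finset.mem_range.2 ht))
  exact Finset.sum_nonneg fun _ _ => Finset.sum_nonneg fun _ _ => sq_nonneg _

lemma lipschitzAt_closedLoop (g : LQGame m d n N) (K : ℕ → Matrix (Fin d) (Fin m) ℝ) {t : ℕ}
    (ht : t < N) : LipschitzAtGauge (gainDist N K) K (fun K' => g.A t - g.B t * K' t) :=
  (LipschitzAtGauge.const _).sub ((LipschitzAtGauge.const _).mul (lipschitzAt_gain K ht))

lemma lipschitzAt_PKaux (g : LQGame m d n N) {K : ℕ → Matrix (Fin d) (Fin m) ℝ}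
    (hK : g.Admissible K) (j : ℕ) (hj : j ≤ N) :
    LipschitzAtGauge (gainDist N K) K (fun K' => g.PKaux K' j) := by
  induction j with
  | zero => exact LipschitzAtGauge.const _
  | succ j ih =>
    have hP := ih (by omega)
    have ht : N - (j + 1) < N := by omega
    have hgain := lipschitzAt_gain K ht
    have hcl := g.lipschitzAt_closedLoop K ht
    have hunit := (hK _ ht).isUnit
    rw [PK, show N - (N - (j + 1) + 1) = j by omega] at hunit
    have hinv := ((LipschitzAtGauge.const (g.Rw (N - (j + 1)))).sub
      (((LipschitzAtGauge.const (g.D (N - (j + 1)))ᵀ).mul hP).mul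
        (LipschitzAtGauge.const (g.D (N - (j + 1)))))).inv hunit
    exact ((LipschitzAtGauge.const _).add
      ((hgain.transpose.mul (LipschitzAtGauge.const _)).mul hgain)).add
      ((hcl.transpose.mul (hP.add ((((hP.mul (LipschitzAtGauge.const _)).mul hinv).mul
        (LipschitzAtGauge.const _)).mul hP))).mul hcl)

lemma lipschitzAt_PK (g : LQGame m d n N) {K : ℕ → Matrix (Fin d) (Fin m) ℝ}
    (hK : g.Admissible K) (t : ℕ) :
    LipschitzAtGauge (gainDist N K) K (fun K' => g.PK K' t) :=
  g.lipschitzAt_PKaux hK (N - t) (N.sub_le t)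

lemma lipschitzAt_Lopt (g : LQGame m d n N) {K : ℕ → Matrix (Fin d) (Fin m) ℝ}
    (hK : g.Admissible K) {t : ℕ} (ht : t < N) :
    LipschitzAtGauge (gainDist N K) K (fun K' => g.Lopt K' t) := by
  have hP := g.lipschitzAt_PK hK (t + 1)
  have hDP := (LipschitzAtGauge.const (g.D t)ᵀ).mul hP
  have hunit : IsUnit (-(g.Rw t) + (g.D t)ᵀ * g.PK K (t + 1) * g.D t) := by
    have h := (hK t ht).isUnit.neg
    rwa [neg_sub, sub_eq_neg_add] at h
  exact (((LipschitzAtGauge.const (-(g.Rw t))).add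
    (hDP.mul (LipschitzAtGauge.const (g.D t)))).inv hunit).mul
      (hDP.mul (g.lipschitzAt_closedLoop K ht))

lemma lipschitzAt_Xcov (g : LQGame m d n N) {K : ℕ → Matrix (Fin d) (Fin m) ℝ}
    (hK : g.Admissible K) (t : ℕ) (ht : t ≤ N) :
    LipschitzAtGauge (gainDist N K) K (fun K' => g.Xcov K' (g.Lopt K') t) := by
  induction t with
  | zero => exact LipschitzAtGauge.const _
  | succ t ih =>
    have hcl := (g.lipschitzAt_closedLoop K ht).sub
      ((LipschitzAtGauge.const (g.D t)).mul (g.lipschitzAt_Lopt hK ht))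
    exact ((hcl.mul (ih (by omega))).mul hcl.transpose).add (LipschitzAtGauge.const _)

end LQGame

end LipschitzAt

/-- local Lipschitz continuity of the Riccati solution `P^K`, the inner
maximizer `L(K)`, and the covariance `X^{K,L(K)}` with respect to the outer gain. -/
theorem LQGame.outer_local_lipschitz {m d n N : ℕ} (g : LQGame m d n N)
    (hN : 0 < N) (K : ℕ → Matrix (Fin d) (Fin m) ℝ) (hK : g.Admissible K) :
    ∃ B1 BP BL BX : ℝ, 0 < B1 ∧ 0 < BP ∧ 0 < BL ∧ 0 < BX ∧
      ∀ K' : ℕ → Matrix (Fin d) (Fin m) ℝ, g.Admissible K' →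
        Real.sqrt (∑ t ∈ Finset.range N, frobNormSq (K' t - K t)) ≤ B1 →
        (∀ t ≤ N, frobNorm (g.PK K' t - g.PK K t)
            ≤ BP * Real.sqrt (∑ t ∈ Finset.range N, frobNormSq (K' t - K t)))
        ∧ (∀ t < N, frobNorm (g.Lopt K' t - g.Lopt K t)
            ≤ BL * Real.sqrt (∑ t ∈ Finset.range N, frobNormSq (K' t - K t)))
        ∧ (∀ t ≤ N, frobNorm (g.Xcov K' (g.Lopt K') t - g.Xcov K (g.Lopt K) t)
            ≤ BX * Real.sqrt (∑ t ∈ Finset.range N, frobNormSq (K' t - K t))) := by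
  have hδ : ∀ K', 0 ≤ gainDist N K K' := fun _ => Real.sqrt_nonneg _
  obtain ⟨BP, hBP, r₁, hr₁, hP⟩ := LipschitzAtGauge.exists_uniform_bound hδ
    (f := fun t K' => g.PK K' t) (s := Finset.range (N + 1)) fun t _ => g.lipschitzAt_PK hK t
  obtain ⟨BL, hBL, r₂, hr₂, hL⟩ := LipschitzAtGauge.exists_uniform_bound hδ
    (f := fun t K' => g.Lopt K' t) (s := Finset.range N)
    fun t ht => g.lipschitzAt_Lopt hK (Finset.mem_range.1 ht)
  obtain ⟨BX, hBX, r₃, hr₃, hX⟩ := LipschitzAtGauge.exists_uniform_bound hδ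
    (f := fun t K' => g.Xcov K' (g.Lopt K') t) (s := Finset.range (N + 1))
    fun t ht => g.lipschitzAt_Xcov hK t (Finset.mem_range_succ_iff.1 ht)
  refine ⟨min r₁ (min r₂ r₃), BP, BL, BX, lt_min hr₁ (lt_min hr₂ hr₃), hBP, hBL, hBX,
    fun K' _ hK' => ⟨fun t ht => ?_, fun t ht => ?_, fun t ht => ?_⟩⟩
  · exact hP K' (hK'.trans (min_le_left _ _)) t (Finset.mem_range_succ_iff.2 ht)
  · exact hL K' (hK'.trans ((min_le_right _ _).trans (min_le_left _ _))) t (Finset.mem_range.2 ht)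
  · exact hX K' (hK'.trans ((min_le_right _ _).trans (min_le_right _ _))) t
      (Finset.mem_range_succ_iff.2 ht)
end
end

section
/- (One-step inner natural-gradient identity and monotonicity.) Fix gains K, L, let η > 0, and define L'_t := L_t + 2η E^{K,L}_t for t ∈ {0,…,N−1}. Then with A^{cl}_t := A_t − B_tK_t − D_tL'_t, for every t ∈ {0,…,N−1}: P^{K,L'}_t − P^{K,L}_t = (A^{cl}_t)ᵀ (P^{K,L'}_{t+1} − P^{K,L}_{t+1}) A^{cl}_t + 4η (E^{K,L}_t)ᵀ (I − η H^{K,L}_t) E^{K,L}_t. Consequently, if K ∈ 𝒦 and η ≤ 1 / max_{0≤t≤N−1} ‖H^{K,L}_t‖, then P^{K,L'}_t ⪰ P^{K,L}_t for all t ∈ {0,…,N}, and hence G(K,L') ≥ G(K,L). -/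
open Matrix

noncomputable section

/-- The Rayleigh set of a Gram matrix is bounded above by the squared Frobenius norm. -/
theorem bddAbove_rayleighSet_transpose_mul_self {a b : ℕ} (M : Matrix (Fin a) (Fin b) ℝ) :
    BddAbove (rayleighSet (Mᵀ * M)) := by
  refine ⟨frobNormSq M, ?_⟩
  rintro _ ⟨x, hx, rfl⟩
  have hx' : ∑ j, x j ^ 2 = 1 := by simpa [dotProduct, pow_two] using hx
  rw [← mulVec_mulVec, dotProduct_mulVec, vecMul_transpose]
  refine Finset.sum_le_sum fun i _ => ?_
  calc (M *ᵥ x) i * (M *ᵥ x) i = (∑ j, M i j * x j) ^ 2 := by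
        simp [mulVec, dotProduct, pow_two]
    _ ≤ (∑ j, M i j ^ 2) * ∑ j, x j ^ 2 := Finset.sum_mul_sq_le_sq_mul_sq _ _ _
    _ = ∑ j, M i j ^ 2 := by rw [hx', mul_one]

/-- The quadratic form of a square matrix is bounded by its operator norm. -/
theorem dotProduct_mulVec_le_opNorm {a : ℕ} (M : Matrix (Fin a) (Fin a) ℝ) (x : Fin a → ℝ) :
    x ⬝ᵥ M *ᵥ x ≤ opNorm M * (x ⬝ᵥ x) := by
  have unit_bound : ∀ y : Fin a → ℝ, y ⬝ᵥ y = 1 → y ⬝ᵥ M *ᵥ y ≤ opNorm M := by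
    intro y hy
    refine Real.le_sqrt_of_sq_le ?_
    calc (y ⬝ᵥ M *ᵥ y) ^ 2 ≤ (y ⬝ᵥ y) * (M *ᵥ y ⬝ᵥ M *ᵥ y) := by
          simpa [dotProduct, pow_two] using
            Finset.sum_mul_sq_le_sq_mul_sq Finset.univ y (M *ᵥ y)
      _ = y ⬝ᵥ (Mᵀ * M) *ᵥ y := by
          rw [hy, one_mul, ← mulVec_mulVec, dotProduct_mulVec y, vecMul_transpose]
      _ ≤ eigMax (Mᵀ * M) :=
          le_csSup (bddAbove_rayleighSet_transpose_mul_self M) ⟨y, hy, rfl⟩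
  rcases eq_or_ne x 0 with rfl | hx
  · simp
  have hpos : 0 < x ⬝ᵥ x := by simpa using dotProduct_star_self_pos_iff.mpr hx
  set s := Real.sqrt (x ⬝ᵥ x) with hs
  have hs0 : 0 < s := Real.sqrt_pos.mpr hpos
  have hss : s * s = x ⬝ᵥ x := Real.mul_self_sqrt hpos.le
  have key := unit_bound (s⁻¹ • x) (by
    rw [smul_dotProduct, dotProduct_smul, ← hss]
    simp only [smul_eq_mul]
    field_simp)
  rw [mulVec_smul, smul_dotProduct, dotProduct_smul, smul_eq_mul, smul_eq_mul] at key
  have := mul_le_mul_of_nonneg_right key hpos.le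
  rw [← hss] at this ⊢
  refine le_trans (le_of_eq ?_) this
  field_simp

/-- The trace of a product of two positive semidefinite matrices is nonnegative. -/
theorem Matrix.PosSemidef.trace_mul_nonneg {a : ℕ} {M S : Matrix (Fin a) (Fin a) ℝ}
    (hM : M.PosSemidef) (hS : S.PosSemidef) : 0 ≤ (M * S).trace := by
  open scoped MatrixOrder in
  obtain ⟨C, rfl⟩ := CStarAlgebra.nonneg_iff_eq_star_mul_self.mp hS.nonneg
  rw [star_eq_conjTranspose, ← Matrix.mul_assoc, trace_mul_comm, ← Matrix.mul_assoc]
  exact (hM.mul_mul_conjTranspose_same C).trace_nonneg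

/-- Completing the square: the effect on one backward value step of changing the maximizer gain
from `L` to `L + (2 * η) • E`, where `E` is the natural-gradient direction at `L`. -/
theorem value_step_gain_update {m n : ℕ} {P P' : Matrix (Fin m) (Fin m) ℝ}
    {R : Matrix (Fin n) (Fin n) ℝ} (hP : Pᵀ = P) (hR : Rᵀ = R)
    (F S : Matrix (Fin m) (Fin m) ℝ) (D : Matrix (Fin m) (Fin n) ℝ)
    {L L' E : Matrix (Fin n) (Fin m) ℝ} (η : ℝ)
    (hE : E = (-R + Dᵀ * P * D) * L - Dᵀ * P * F) (hL' : L' = L + (2 * η) • E) :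
    ((F - D * L')ᵀ * P' * (F - D * L') + S - L'ᵀ * R * L')
        - ((F - D * L)ᵀ * P * (F - D * L) + S - Lᵀ * R * L)
      = (F - D * L')ᵀ * (P' - P) * (F - D * L')
        + (4 * η) • (Eᵀ * (1 - η • (R - Dᵀ * P * D)) * E) := by
  have hEt : Eᵀ = Lᵀ * (-R + Dᵀ * P * D) - Fᵀ * P * D := by
    rw [hE]
    simp [transpose_mul, hP, hR, Matrix.mul_assoc]
  have hcross : (F - D * L')ᵀ * P * (F - D * L') - L'ᵀ * R * L'
      - ((F - D * L)ᵀ * P * (F - D * L) - Lᵀ * R * L)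
      = (2 * η) • (Eᵀ * E) + (2 * η) • (Eᵀ * E)
        - (2 * η) • (2 * η) • (Eᵀ * (R - Dᵀ * P * D) * E) := by
    have h1 : (2 * η) • (Eᵀ * E)
        = (2 * η) • ((Lᵀ * (-R + Dᵀ * P * D) - Fᵀ * P * D) * E) := by rw [hEt]
    have h2 : (2 * η) • (Eᵀ * E)
        = (2 * η) • (Eᵀ * ((-R + Dᵀ * P * D) * L - Dᵀ * P * F)) := by rw [← hE]
    nth_rewrite 1 [h1]
    rw [h2, hL']
    clear h1 h2 hE hEt hL'
    simp only [transpose_sub, transpose_add, transpose_mul, transpose_smul, Matrix.mul_add,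
      Matrix.add_mul, Matrix.mul_sub, Matrix.sub_mul, Matrix.smul_mul, Matrix.mul_smul,
      smul_add, smul_sub, Matrix.mul_assoc, Matrix.neg_mul, Matrix.mul_neg, smul_neg]
    abel
  have hscal : (2 * η) • (Eᵀ * E) + (2 * η) • (Eᵀ * E)
        - (2 * η) • (2 * η) • (Eᵀ * (R - Dᵀ * P * D) * E)
      = (4 * η) • (Eᵀ * (1 - η • (R - Dᵀ * P * D)) * E) := by
    rw [Matrix.mul_sub Eᵀ 1, Matrix.mul_one, Matrix.sub_mul Eᵀ, Matrix.mul_smul, Matrix.smul_mul]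
    module
  rw [← hscal, ← hcross, Matrix.mul_sub _ P' P, Matrix.sub_mul (_ * P')]
  abel

namespace LQGame

variable {m d n N : ℕ}

theorem PKL_terminal (g : LQGame m d n N) (K : ℕ → Matrix (Fin d) (Fin m) ℝ)
    (L : ℕ → Matrix (Fin n) (Fin m) ℝ) : g.PKL K L N = g.QN := by
  rw [PKL, Nat.sub_self, PKLaux]

/-- Backward recursion for the value matrices, in forward time. -/
theorem PKL_step (g : LQGame m d n N) (K : ℕ → Matrix (Fin d) (Fin m) ℝ)
    (L : ℕ → Matrix (Fin n) (Fin m) ℝ) {t : ℕ} (ht : t < N) :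
    g.PKL K L t = (g.A t - g.B t * K t - g.D t * L t)ᵀ * g.PKL K L (t + 1) *
        (g.A t - g.B t * K t - g.D t * L t)
      + (g.Q t + (K t)ᵀ * g.Ru t * K t) - (L t)ᵀ * g.Rw t * L t := by
  obtain ⟨j, hj⟩ : ∃ j, N - t = j + 1 := ⟨N - t - 1, by omega⟩
  have hj' : N - (t + 1) = j := by omega
  have hjt : N - (j + 1) = t := by omega
  rw [PKL, PKL, hj, hj', PKLaux, hjt, add_assoc _ (g.Q t)]

theorem transpose_PKL (g : LQGame m d n N) (K : ℕ → Matrix (Fin d) (Fin m) ℝ)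
    (L : ℕ → Matrix (Fin n) (Fin m) ℝ) {t : ℕ} (ht : t ≤ N) :
    (g.PKL K L t)ᵀ = g.PKL K L t := by
  induction ht using Nat.decreasingInduction with
  | self => rw [PKL_terminal]; exact g.hQN.isHermitian
  | of_succ t ht ih =>
    have hQ : (g.Q t)ᵀ = g.Q t := (g.hQ t ht).isHermitian
    have hRu : (g.Ru t)ᵀ = g.Ru t := (g.hRu t ht).isHermitian
    have hRw : (g.Rw t)ᵀ = g.Rw t := (g.hRw t ht).isHermitian
    rw [g.PKL_step K L ht]
    simp only [transpose_sub, transpose_add, transpose_mul, transpose_transpose, hQ, hRu, hRw,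
      ih, Matrix.mul_assoc]

theorem transpose_Hmat (g : LQGame m d n N) (K : ℕ → Matrix (Fin d) (Fin m) ℝ)
    (L : ℕ → Matrix (Fin n) (Fin m) ℝ) {t : ℕ} (ht : t < N) :
    (g.Hmat K L t)ᵀ = g.Hmat K L t := by
  have hRw : (g.Rw t)ᵀ = g.Rw t := (g.hRw t ht).isHermitian
  simp only [Hmat, transpose_sub, transpose_mul, transpose_transpose, hRw,
    g.transpose_PKL K L ht, Matrix.mul_assoc]

end LQGame

/-- `1 - η M` is positive semidefinite for symmetric `M` once `η * opNorm M ≤ 1`. -/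
theorem posSemidef_one_sub_smul {a : ℕ} {M : Matrix (Fin a) (Fin a) ℝ} (hM : Mᵀ = M) {η : ℝ}
    (hη : 0 ≤ η) (h : η * opNorm M ≤ 1) : (1 - η • M).PosSemidef := by
  refine .of_dotProduct_mulVec_nonneg ?_ fun x => ?_
  · rw [IsHermitian, conjTranspose_eq_transpose_of_trivial]
    simp [hM]
  · have hx : 0 ≤ x ⬝ᵥ x := by simpa using dotProduct_star_self_nonneg x
    have h1 := mul_le_mul_of_nonneg_left (dotProduct_mulVec_le_opNorm M x) hη
    have h2 := mul_le_mul_of_nonneg_right h hx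
    rw [star_trivial, sub_mulVec, one_mulVec, smul_mulVec, dotProduct_sub, dotProduct_smul,
      smul_eq_mul]
    linarith

/-- one-step inner natural-gradient identity and monotonicity. -/
theorem LQGame.inner_npg_one_step {m d n N : ℕ} (g : LQGame m d n N) (hN : 0 < N)
    (K : ℕ → Matrix (Fin d) (Fin m) ℝ) (L : ℕ → Matrix (Fin n) (Fin m) ℝ)
    (η : ℝ) (hη0 : 0 < η) (L' : ℕ → Matrix (Fin n) (Fin m) ℝ)
    (hL' : ∀ t < N, L' t = L t + (2 * η) • g.Emat K L t) :
    (∀ t < N,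
      g.PKL K L' t - g.PKL K L t =
        (g.A t - g.B t * K t - g.D t * L' t)ᵀ * (g.PKL K L' (t+1) - g.PKL K L (t+1)) *
          (g.A t - g.B t * K t - g.D t * L' t)
        + (4 * η) • ((g.Emat K L t)ᵀ * (1 - η • g.Hmat K L t) * g.Emat K L t))
    ∧ (g.Admissible K →
        η ≤ 1 / (Finset.range N).sup' (Finset.nonempty_range_iff.mpr hN.ne')
          (fun t => opNorm (g.Hmat K L t)) →
        (∀ t ≤ N, (g.PKL K L' t - g.PKL K L t).PosSemidef)
        ∧ g.value K L ≤ g.value K L') := by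
  have identity : ∀ t < N,
      g.PKL K L' t - g.PKL K L t =
        (g.A t - g.B t * K t - g.D t * L' t)ᵀ * (g.PKL K L' (t+1) - g.PKL K L (t+1)) *
          (g.A t - g.B t * K t - g.D t * L' t)
        + (4 * η) • ((g.Emat K L t)ᵀ * (1 - η • g.Hmat K L t) * g.Emat K L t) := by
    intro t ht
    rw [g.PKL_step K L ht, g.PKL_step K L' ht]
    exact value_step_gain_update (g.transpose_PKL K L ht) (g.hRw t ht).isHermitian _ _ _ η rfl
      (hL' t ht)
  refine ⟨identity, fun _ hη => ?_⟩
  have mono : ∀ t ≤ N, (g.PKL K L' t - g.PKL K L t).PosSemidef := by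
    intro t ht
    induction ht using Nat.decreasingInduction with
    | self => rw [PKL_terminal, PKL_terminal, sub_self]; exact .zero
    | of_succ t ht ih =>
      have hbound : η * opNorm (g.Hmat K L t) ≤ 1 := by
        have hsup := one_div_pos.mp (hη0.trans_le hη)
        refine le_trans (mul_le_mul_of_nonneg_left ?_ hη0.le) ((le_div_iff₀ hsup).mp hη)
        exact Finset.le_sup' (fun t => opNorm (g.Hmat K L t)) (Finset.mem_range.mpr ht)
      rw [identity t ht, ← conjTranspose_eq_transpose_of_trivial,
        ← conjTranspose_eq_transpose_of_trivial]
      exact (ih.conjTranspose_mul_mul_same _).add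
        (((posSemidef_one_sub_smul (g.transpose_Hmat K L ht) hη0.le
          hbound).conjTranspose_mul_mul_same _).smul (by positivity))
  refine ⟨mono, Finset.sum_le_sum fun t ht => ?_⟩
  have ht' : t ≤ N := Nat.lt_succ_iff.mp (Finset.mem_range.mp ht)
  have htrace := (mono t ht').trace_mul_nonneg (g.hSig t ht').posSemidef
  rw [Matrix.sub_mul, trace_sub] at htrace
  exact sub_nonneg.mp htrace
end
end
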